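/- For every d ≥ 11, the graph H_d on n = 3d vertices admits a planar straight-line grid drawing of height 4, while every planar straight-line grid drawing of H_d of height 4 has width at least (1/3)·2^d = (1/3)·2^{n/3}. -/

import Mathlib

open Set

noncomputable section

/-- Points of the plane. -/
abbrev Pt : Type := ℝ × ℝ

/-- The image (set of points) of a polygonal chain given by its list of breakpoints. -/
def chainSet : List Pt → Set Pt
  | [] => ∅
  | [p] => {p}
  | p :: q :: rest => segment ℝ p q ∪ chainSet (q :: rest)

/-- The bends (interior junction points) of a polygonal chain. -/
def chainBends (l : List Pt) : List Pt := (l.drop 1).dropLast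

/-- `S` is the image of a simple (injective) curve from `a` to `b`. -/
def IsSimpleArc (S : Set Pt) (a b : Pt) : Prop :=
  ∃ γ : ℝ → Pt, ContinuousOn γ (Icc (0:ℝ) 1) ∧ InjOn γ (Icc (0:ℝ) 1) ∧
    γ '' Icc (0:ℝ) 1 = S ∧ γ 0 = a ∧ γ 1 = b

/-- A poly-line drawing of a simple graph `G`: an injective placement of the vertices
together with, for each edge, a simple polygonal arc joining the endpoints. -/
structure PolyDrawing {V : Type} (G : SimpleGraph V) where
  pos : V → Pt
  pos_inj : Function.Injective pos
  arc : Sym2 V → List Pt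
  arc_ends : ∀ u v : V, G.Adj u v →
    ((arc s(u, v)).head? = some (pos u) ∧ (arc s(u, v)).getLast? = some (pos v)) ∨
    ((arc s(u, v)).head? = some (pos v) ∧ (arc s(u, v)).getLast? = some (pos u))
  arc_simple : ∀ u v : V, G.Adj u v →
    IsSimpleArc (chainSet (arc s(u, v))) (pos u) (pos v)

namespace PolyDrawing

variable {V : Type} {G : SimpleGraph V}

/-- The set of points used by the arc of an edge. -/
def edgePts (Γ : PolyDrawing G) (e : Sym2 V) : Set Pt := chainSet (Γ.arc e)

/-- Planarity: no vertex point lies on the arc of a non-incident edge, and arcs of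
distinct edges meet only in images of common endpoints. -/
def IsPlanar (Γ : PolyDrawing G) : Prop :=
  (∀ v : V, ∀ e ∈ G.edgeSet, v ∉ e → Γ.pos v ∉ Γ.edgePts e) ∧
  (∀ e ∈ G.edgeSet, ∀ f ∈ G.edgeSet, e ≠ f →
    ∀ p ∈ Γ.edgePts e ∩ Γ.edgePts f, ∃ w : V, w ∈ e ∧ w ∈ f ∧ p = Γ.pos w)

/-- `y`-monotone: along every edge arc the `y`-coordinate varies weakly monotonically. -/
def IsYMonotone (Γ : PolyDrawing G) : Prop :=
  ∀ e ∈ G.edgeSet,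
    List.Chain' (· ≤ ·) ((Γ.arc e).map Prod.snd) ∨
    List.Chain' (· ≥ ·) ((Γ.arc e).map Prod.snd)

/-- The drawing has height `h`: every vertex and every bend has an integer
`y`-coordinate in `{1, …, h}`. -/
def HasHeight (Γ : PolyDrawing G) (h : ℕ) : Prop :=
  (∀ v : V, ∃ k : ℤ, 1 ≤ k ∧ k ≤ (h : ℤ) ∧ (Γ.pos v).2 = (k : ℝ)) ∧
  (∀ e ∈ G.edgeSet, ∀ p ∈ chainBends (Γ.arc e), ∃ k : ℤ, 1 ≤ k ∧ k ≤ (h : ℤ) ∧ p.2 = (k : ℝ))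

/-- All vertices and bends have integer `y`-coordinates. -/
def IntegerY (Γ : PolyDrawing G) : Prop :=
  (∀ v : V, ∃ k : ℤ, (Γ.pos v).2 = (k : ℝ)) ∧
  (∀ e ∈ G.edgeSet, ∀ p ∈ chainBends (Γ.arc e), ∃ k : ℤ, p.2 = (k : ℝ))

/-- The set of all points of the drawing (vertex points and edge arcs). -/
def image (Γ : PolyDrawing G) : Set Pt :=
  Set.range Γ.pos ∪ ⋃ e ∈ G.edgeSet, Γ.edgePts e

/-- The union of the unbounded connected components of the complement of the drawing. -/
def outerRegion (Γ : PolyDrawing G) : Set Pt :=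
  {p | p ∉ Γ.image ∧ ¬ Bornology.IsBounded (connectedComponentIn Γ.imageᶜ p)}

/-- A vertex is inner if its point does not lie on the boundary of the unbounded
connected component of the complement of the drawing. -/
def IsInner (Γ : PolyDrawing G) (v : V) : Prop :=
  Γ.pos v ∉ frontier Γ.outerRegion

/-- Number of incoming edges at `v` (edges whose other endpoint is weakly below `v`;
horizontal edges count as incoming). -/
def indeg (Γ : PolyDrawing G) (v : V) : ℕ :=
  {w : V | G.Adj v w ∧ (Γ.pos w).2 ≤ (Γ.pos v).2}.ncard

/-- Number of outgoing edges at `v` (edges whose other endpoint is weakly above `v`;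
horizontal edges count as outgoing). -/
def outdeg (Γ : PolyDrawing G) (v : V) : ℕ :=
  {w : V | G.Adj v w ∧ (Γ.pos v).2 ≤ (Γ.pos w).2}.ncard

/-- The set of points drawn for an element (vertex or edge) of the graph. -/
def drawSet (Γ : PolyDrawing G) : V ⊕ ↥G.edgeSet → Set Pt
  | Sum.inl v => {Γ.pos v}
  | Sum.inr e => Γ.edgePts e

end PolyDrawing

/-- A straight-line drawing of a simple graph: an injective placement of the vertices;
each edge is drawn as the closed segment between its endpoints. -/
structure StraightDrawing {V : Type} (G : SimpleGraph V) where
  pos : V → Pt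
  pos_inj : Function.Injective pos

namespace StraightDrawing

variable {V : Type} {G : SimpleGraph V}

/-- The closed segment representing an edge. -/
def edgePts (Γ : StraightDrawing G) (e : Sym2 V) : Set Pt :=
  Sym2.lift ⟨fun u v => segment ℝ (Γ.pos u) (Γ.pos v),
    fun u v => segment_symm (𝕜 := ℝ) (Γ.pos u) (Γ.pos v)⟩ e

/-- Planarity of a straight-line drawing. -/
def IsPlanar (Γ : StraightDrawing G) : Prop :=
  (∀ v : V, ∀ e ∈ G.edgeSet, v ∉ e → Γ.pos v ∉ Γ.edgePts e) ∧
  (∀ e ∈ G.edgeSet, ∀ f ∈ G.edgeSet, e ≠ f →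
    ∀ p ∈ Γ.edgePts e ∩ Γ.edgePts f, ∃ w : V, w ∈ e ∧ w ∈ f ∧ p = Γ.pos w)

/-- Every vertex has an integer `y`-coordinate in `{1, …, h}`. -/
def HeightLe (Γ : StraightDrawing G) (h : ℕ) : Prop :=
  ∀ v : V, ∃ k : ℤ, 1 ≤ k ∧ k ≤ (h : ℤ) ∧ (Γ.pos v).2 = (k : ℝ)

/-- All vertices lie on integer grid points. -/
def IsGrid (Γ : StraightDrawing G) : Prop :=
  ∀ v : V, ∃ p : ℤ × ℤ, Γ.pos v = ((p.1 : ℝ), (p.2 : ℝ))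

/-- The set of points drawn for an element (vertex or edge) of the graph. -/
def drawSet (Γ : StraightDrawing G) : V ⊕ ↥G.edgeSet → Set Pt
  | Sum.inl v => {Γ.pos v}
  | Sum.inr e => Γ.edgePts e

end StraightDrawing

/-- The intersection of a set of points with the horizontal line `y = r`,
recorded as a set of `x`-coordinates. -/
def rowSlice (S : Set Pt) (r : ℝ) : Set ℝ := {x : ℝ | (x, r) ∈ S}

/-- Two drawings (given by the sets drawn for each vertex/edge element) have the same
left-to-right order in each row: for every integer row `r` and elements `a`, `b` both
meeting row `r` in both drawings, the drawing of `a` lies entirely strictly to the left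
of that of `b` in one drawing iff it does in the other. -/
def SameRowOrder {α : Type} (D D' : α → Set Pt) : Prop :=
  ∀ r : ℤ, ∀ a b : α,
    (rowSlice (D a) (r : ℝ)).Nonempty → (rowSlice (D b) (r : ℝ)).Nonempty →
    (rowSlice (D' a) (r : ℝ)).Nonempty → (rowSlice (D' b) (r : ℝ)).Nonempty →
    ((∀ x ∈ rowSlice (D a) (r : ℝ), ∀ y ∈ rowSlice (D b) (r : ℝ), x < y) ↔
     (∀ x ∈ rowSlice (D' a) (r : ℝ), ∀ y ∈ rowSlice (D' b) (r : ℝ), x < y))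

/-- A simple graph on `n ≥ 3` vertices is triangulated (maximal planar) if it admits a
planar poly-line drawing and has exactly `3n - 6` edges. -/
def IsTriangulated {V : Type} [Fintype V] (G : SimpleGraph V) : Prop :=
  3 ≤ Fintype.card V ∧ G.edgeSet.ncard = 3 * Fintype.card V - 6 ∧
  ∃ Γ : PolyDrawing G, Γ.IsPlanar

/-- Data of a flat visibility representation: a horizontal segment for every vertex
(given by its `y`-coordinate and left/right `x`-coordinates) and a segment (given by
its two endpoints) for every edge. -/
structure VisData (V : Type) where
  ly : V → ℝ
  lx : V → ℝ
  rx : V → ℝ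
  ep1 : Sym2 V → Pt
  ep2 : Sym2 V → Pt

/-- The horizontal segment of a vertex. -/
def VisData.vseg {V : Type} (D : VisData V) (v : V) : Set Pt :=
  segment ℝ (D.lx v, D.ly v) (D.rx v, D.ly v)

/-- The segment of an edge. -/
def VisData.eseg {V : Type} (D : VisData V) (e : Sym2 V) : Set Pt :=
  segment ℝ (D.ep1 e) (D.ep2 e)

/-- `D` is a planar flat visibility representation of `G` of height `h`. -/
def IsFlatVisRep {V : Type} (G : SimpleGraph V) (D : VisData V) (h : ℕ) : Prop :=
  (∀ v : V, D.lx v ≤ D.rx v) ∧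
  (∀ v : V, ∃ k : ℤ, 1 ≤ k ∧ k ≤ (h : ℤ) ∧ D.ly v = (k : ℝ)) ∧
  (∀ e ∈ G.edgeSet, (D.ep1 e).1 = (D.ep2 e).1 ∨ (D.ep1 e).2 = (D.ep2 e).2) ∧
  (∀ e ∈ G.edgeSet, ∀ p ∈ D.eseg e, 1 ≤ p.2 ∧ p.2 ≤ (h : ℝ)) ∧
  (∀ u v : V, G.Adj u v →
    (D.ep1 s(u, v) ∈ D.vseg u ∧ D.ep2 s(u, v) ∈ D.vseg v) ∨
    (D.ep1 s(u, v) ∈ D.vseg v ∧ D.ep2 s(u, v) ∈ D.vseg u)) ∧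
  (∀ u v : V, u ≠ v → Disjoint (D.vseg u) (D.vseg v)) ∧
  (∀ e ∈ G.edgeSet, ∀ w : V, ∀ p ∈ D.eseg e ∩ D.vseg w, p = D.ep1 e ∨ p = D.ep2 e) ∧
  (∀ e ∈ G.edgeSet, ∀ f ∈ G.edgeSet, e ≠ f → ∀ p ∈ D.eseg e ∩ D.eseg f,
    (p = D.ep1 e ∨ p = D.ep2 e) ∧ (p = D.ep1 f ∨ p = D.ep2 f))

end

/-- Vertices of the graph `H_d`: `u`, `v`, path vertices `a_0, …, a_{d-1}`
(representing `a_1, …, a_d`), and added vertices `b_i`, `c_i` for `0 ≤ i ≤ d - 2`. -/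
inductive HVert (d : ℕ) : Type where
  | u : HVert d
  | v : HVert d
  | a : Fin d → HVert d
  | b : Fin (d - 1) → HVert d
  | c : Fin (d - 1) → HVert d
deriving DecidableEq

/-- Base relation generating the edges of `H_d`. -/
def HRel (d : ℕ) : HVert d → HVert d → Prop
  | .u, .v => True
  | .u, .a _ => True
  | .v, .a _ => True
  | .a i, .a j => (j : ℕ) = (i : ℕ) + 1
  | .b _, .u => True
  | .b i, .a j => (j : ℕ) = (i : ℕ) ∨ (j : ℕ) = (i : ℕ) + 1
  | .c _, .v => True
  | .c i, .a j => (j : ℕ) = (i : ℕ) ∨ (j : ℕ) = (i : ℕ) + 1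
  | _, _ => False

/-- The graph `H_d` on `n = 3d` vertices: `G_d` (the vertices `u`, `v`, the path
`a_1 … a_d`, with `u`, `v` adjacent to each other and to all `a_i`) together with the
vertices `b_i` adjacent exactly to `u, a_i, a_{i+1}` and `c_i` adjacent exactly to
`v, a_i, a_{i+1}`. -/
def Hgraph (d : ℕ) : SimpleGraph (HVert d) := SimpleGraph.fromRel (HRel d)

/-- Twice the signed area of the triangle `p q r`. -/
noncomputable def orient (p q r : Pt) : ℝ :=
  (q.1 - p.1) * (r.2 - p.2) - (q.2 - p.2) * (r.1 - p.1)

/-- `p` lies in the open triangle `x y z`, in terms of signs of orientations. -/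
def InTri (x y z p : Pt) : Prop :=
  0 < orient y z p * orient x y z ∧ 0 < orient z x p * orient x y z ∧
    0 < orient x y p * orient x y z

lemma orient_rotate (x y z : Pt) : orient y z x = orient x y z := by
  simp only [orient]; ring

lemma orient_swap (x y z : Pt) : orient y x z = -orient x y z := by
  simp only [orient]; ring

lemma InTri.rotate {x y z p : Pt} (h : InTri x y z p) : InTri y z x p := by
  obtain ⟨h₁, h₂, h₃⟩ := h
  exact ⟨by rwa [orient_rotate x y z], by rwa [orient_rotate x y z], by rwa [orient_rotate x y z]⟩

lemma InTri.swap {x y z p : Pt} (h : InTri x y z p) : InTri y x z p := by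
  obtain ⟨h₁, h₂, h₃⟩ := h
  refine ⟨?_, ?_, ?_⟩
  · rw [orient_swap z x, orient_swap x y]; simpa using h₂
  · rw [orient_swap y z, orient_swap x y]; simpa using h₁
  · rw [orient_swap x y, orient_swap x y]; simpa using h₃

lemma InTri.orient_ne_zero {x y z p : Pt} (h : InTri x y z p) : orient x y z ≠ 0 := by
  intro h0; simpa [h0] using h.1

lemma orient_sum (x y z p : Pt) :
    orient y z p + orient z x p + orient x y p = orient x y z := by
  simp only [orient]; ring

lemma InTri.same_side {x y z p : Pt} (h : InTri x y z p) :
    0 < orient x y p * orient x y z := h.2.2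

/-- If `p` is inside the triangle with base `x y` and apex `z`, then `z` is not inside the
triangle with the same base and apex `p`. -/
lemma InTri.not_symm {x y z p : Pt} (h : InTri x y z p) : ¬ InTri x y p z := by
  intro h'
  have e : orient y p z = -orient y z p := by simp only [orient]; ring
  have h1 := mul_pos (mul_pos h.1 h'.1) h.2.2
  rw [e] at h1
  nlinarith [sq_nonneg (orient y z p * orient x y z * orient x y p)]

/-- Barycentric coordinates. -/
lemma barycentric {x y z : Pt} (h : orient x y z ≠ 0) (p : Pt) :
    p = (orient y z p / orient x y z) • x + (orient z x p / orient x y z) • y +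
      (orient x y p / orient x y z) • z := by
  ext
  · simp only [Prod.fst_add, Prod.smul_fst, smul_eq_mul]
    field_simp
    simp only [orient]; ring
  · simp only [Prod.snd_add, Prod.smul_snd, smul_eq_mul]
    field_simp
    simp only [orient]; ring

lemma InTri.exists_weights {x y z p : Pt} (h : InTri x y z p) :
    ∃ α β γ : ℝ, 0 < α ∧ 0 < β ∧ 0 < γ ∧ α + β + γ = 1 ∧ p = α • x + β • y + γ • z ∧
      orient x y p = γ * orient x y z := by
  have h0 := h.orient_ne_zero
  have key : ∀ a : ℝ, 0 < a * orient x y z → 0 < a / orient x y z := by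
    intro a ha
    have : a / orient x y z = a * orient x y z / (orient x y z) ^ 2 := by field_simp
    rw [this]; positivity
  refine ⟨_, _, _, key _ h.1, key _ h.2.1, key _ h.2.2, ?_, barycentric h0 p, by field_simp⟩
  rw [← add_div, ← add_div, orient_sum, div_self h0]

lemma mem_segment_of_orient_eq_zero {x y z p : Pt} (h : orient x y z ≠ 0)
    (hz : orient x y p = 0) (hx : 0 ≤ orient y z p * orient x y z)
    (hy : 0 ≤ orient z x p * orient x y z) : p ∈ segment ℝ x y := by
  have key : ∀ a : ℝ, 0 ≤ a * orient x y z → 0 ≤ a / orient x y z := by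
    intro a ha
    have : a / orient x y z = a * orient x y z / (orient x y z) ^ 2 := by field_simp
    rw [this]; positivity
  have e := orient_sum x y z p
  have b := barycentric h p
  rw [hz] at e b
  refine ⟨_, _, key _ hx, key _ hy, ?_, ?_⟩
  · rw [← add_div, ← add_zero (_ + _), e, div_self h]
  · conv_rhs => rw [b]
    simp

lemma orient_lineMap (x y p q : Pt) (t : ℝ) :
    orient x y ((1 - t) • p + t • q) = (1 - t) * orient x y p + t * orient x y q := by
  simp only [orient, Prod.fst_add, Prod.snd_add, Prod.smul_fst, Prod.smul_snd, smul_eq_mul]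
  ring

/-- A segment leaving an open triangle meets one of its sides. -/
lemma InTri.exit {x y z p w : Pt} (hp : InTri x y z p) (hw : ¬ InTri x y z w) :
    ∃ q ∈ segment ℝ p w, q ∈ segment ℝ x y ∨ q ∈ segment ℝ y z ∨ q ∈ segment ℝ z x := by
  have h0 := hp.orient_ne_zero
  set D := orient x y z with hD
  let pt : ℝ → Pt := fun t => (1 - t) • p + t • w
  let g : ℝ → ℝ := fun t => min (orient y z (pt t) * D) (min (orient z x (pt t) * D)
    (orient x y (pt t) * D))
  have hcont : Continuous g := by
    simp only [g, pt, orient_lineMap]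
    fun_prop
  have g0 : 0 < g 0 := by
    simp only [g, pt, orient_lineMap]
    simpa [lt_min_iff, InTri, hD] using hp
  have g1 : g 1 ≤ 0 := by
    by_contra hc
    rw [not_le] at hc
    simp only [g, pt, orient_lineMap] at hc
    exact hw (by simpa [lt_min_iff, InTri, hD] using hc)
  obtain ⟨t, ht, hgt⟩ := intermediate_value_Icc' (zero_le_one' ℝ) hcont.continuousOn ⟨g1, g0.le⟩
  have l1 : 0 ≤ orient y z (pt t) * D := hgt ▸ min_le_left _ _
  have l2 : 0 ≤ orient z x (pt t) * D := hgt ▸ (min_le_right _ _).trans (min_le_left _ _)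
  have l3 : 0 ≤ orient x y (pt t) * D := hgt ▸ (min_le_right _ _).trans (min_le_right _ _)
  refine ⟨pt t, ⟨1 - t, t, by linarith [ht.2], ht.1, by ring, rfl⟩, ?_⟩
  have hz : orient y z (pt t) = 0 ∨ orient z x (pt t) = 0 ∨ orient x y (pt t) = 0 := by
    by_contra! hc
    obtain ⟨c1, c2, c3⟩ := hc
    have m1 := lt_of_le_of_ne l1 (mul_ne_zero c1 h0).symm
    have m2 := lt_of_le_of_ne l2 (mul_ne_zero c2 h0).symm
    have m3 := lt_of_le_of_ne l3 (mul_ne_zero c3 h0).symm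
    have : 0 < g t := lt_min m1 (lt_min m2 m3)
    linarith
  rcases hz with hz | hz | hz
  · refine .inr (.inl (mem_segment_of_orient_eq_zero (z := x) ?_ hz ?_ ?_)) <;>
      rwa [orient_rotate x y z]
  · refine .inr (.inr (mem_segment_of_orient_eq_zero (z := y) ?_ hz ?_ ?_)) <;>
      rwa [orient_rotate y z x, orient_rotate x y z]
  · exact .inl (mem_segment_of_orient_eq_zero h0 hz l1 l2)

lemma not_disjoint_of_orient {x y p q : Pt} (h : 0 < orient x y p * orient x y q)
    (hA : orient y q p * orient x y q < 0) (hB : 0 < orient q x p * orient x y q) :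
    ¬ Disjoint (segment ℝ x p) (segment ℝ y q) := by
  have hQ : orient x y q ≠ 0 := by intro h; simp [h] at hB
  have e := orient_sum x y q p
  have b := barycentric hQ p
  set A := orient y q p
  set B := orient q x p
  set P := orient x y p
  set Q := orient x y q
  have hS : Q - A ≠ 0 := by
    intro h0
    have : Q = A := by linarith
    rw [this] at hA
    nlinarith
  have hS2 : 0 < (Q - A) * Q := by nlinarith [sq_nonneg Q]
  have key : ∀ a : ℝ, 0 ≤ a * Q → 0 ≤ a / (Q - A) := by
    intro a ha
    have : a / (Q - A) = (a * Q) * ((Q - A) * Q) / ((Q - A) * Q) ^ 2 := by field_simp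
    rw [this]; positivity
  rw [Set.not_disjoint_iff]
  refine ⟨(-A / (Q - A)) • x + (Q / (Q - A)) • p,
    ⟨_, _, key _ (by nlinarith), key _ (by nlinarith), ?_, rfl⟩,
    ⟨B / (Q - A), P / (Q - A), key _ hB.le, key _ h.le, ?_, ?_⟩⟩
  · field_simp; ring
  · field_simp; linarith
  · conv_rhs => rw [b]
    have e1 : ∀ c : ℝ, Q / (Q - A) * (c / Q) = c / (Q - A) := by intro c; field_simp
    simp only [smul_add, smul_smul, e1]
    rw [← add_assoc, ← add_assoc, ← add_smul, ← add_div]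
    simp

/-- Two triangles over the base `x y` with apexes `p`, `q` on the same side are nested as soon
as their legs do not cross and neither apex lies on a leg of the other one. -/
lemma inTri_or_inTri {x y p q : Pt} (hs : 0 < orient x y p * orient x y q)
    (h₁ : Disjoint (segment ℝ x p) (segment ℝ y q)) (h₂ : Disjoint (segment ℝ y p) (segment ℝ x q))
    (hp₁ : p ∉ segment ℝ x q) (hp₂ : p ∉ segment ℝ y q)
    (hq₁ : q ∉ segment ℝ x p) (hq₂ : q ∉ segment ℝ y p) :
    InTri x y q p ∨ InTri x y p q := by
  have hp0 : orient x y p ≠ 0 := by rintro h; simp [h] at hs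
  have hq0 : orient x y q ≠ 0 := by rintro h; simp [h] at hs
  have e1 : orient y p q = -orient y q p := by simp only [orient]; ring
  have e2 : orient p x q = -orient q x p := by simp only [orient]; ring
  have e3 : orient x q p = -orient q x p := orient_swap ..
  have e4 : orient q y p = -orient y q p := orient_swap ..
  have e5 : orient y x p = -orient x y p := orient_swap ..
  have e6 : orient y x q = -orient x y q := orient_swap ..
  have f1 : orient y q x = orient x y q := orient_rotate ..
  have f2 : orient q x y = orient x y q := by simp only [orient]; ring
  have f3 : orient y p x = orient x y p := orient_rotate ..
  have f4 : orient p x y = orient x y p := by simp only [orient]; ring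
  have tr : ∀ a : ℝ, a * orient x y q < 0 → 0 < -a * orient x y p := by
    intro a ha
    by_contra hc
    have ha0 : a ≠ 0 := by rintro rfl; simp at ha
    have h2 : 0 < a ^ 2 := by positivity
    nlinarith [mul_pos h2 hs]
  rcases lt_trichotomy (orient y q p * orient x y q) 0 with hA | hA | hA
  · rcases lt_trichotomy (orient q x p * orient x y q) 0 with hB | hB | hB
    · exact .inr ⟨by rw [e1]; exact tr _ hA, by rw [e2]; exact tr _ hB, by rwa [mul_comm]⟩
    · have hB' : orient q x p = 0 := by simpa [hq0] using hB
      refine absurd ?_ hq₁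
      rw [segment_symm]
      refine mem_segment_of_orient_eq_zero (z := y) ?_ ?_ ?_ ?_
      · rwa [f4]
      · rw [e2, hB', neg_zero]
      · rw [f4]; nlinarith
      · rw [e1, f4]; exact (tr _ hA).le
    · exact absurd h₁ (not_disjoint_of_orient hs hA hB)
  · have hA' : orient y q p = 0 := by simpa [hq0] using hA
    rcases lt_or_ge (orient q x p * orient x y q) 0 with hB | hB
    · refine absurd ?_ hq₂
      refine mem_segment_of_orient_eq_zero (z := x) ?_ ?_ ?_ ?_
      · rwa [f3]
      · rw [e1, hA', neg_zero]
      · rw [f3, e2]; exact (tr _ hB).le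
      · rw [f3]; nlinarith
    · refine absurd ?_ hp₂
      refine mem_segment_of_orient_eq_zero (z := x) ?_ hA' ?_ ?_
      · rwa [f1]
      · rwa [f1]
      · rw [f1]; exact hs.le
  · rcases lt_trichotomy (orient q x p * orient x y q) 0 with hB | hB | hB
    · refine absurd h₂ (not_disjoint_of_orient ?_ ?_ ?_)
      · rw [e5, e6]; linarith
      · rw [e3, e6]; linarith
      · rw [e4, e6]; linarith
    · have hB' : orient q x p = 0 := by simpa [hq0] using hB
      refine absurd ?_ hp₁
      rw [segment_symm]
      refine mem_segment_of_orient_eq_zero (z := y) ?_ hB' ?_ ?_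
      · rwa [f2]
      · rw [f2]; exact hs.le
      · rw [f2]; exact hA.le
    · exact .inl ⟨hA, hB, hs⟩

lemma mem_segment_of_orient_eq_zero' {x y z : Pt} (h : orient x y z = 0) :
    x ∈ segment ℝ y z ∨ y ∈ segment ℝ z x ∨ z ∈ segment ℝ x y := by
  have hcol : Collinear ℝ {x, y, z} := by
    by_cases hxy : y = x
    · subst hxy; simpa using collinear_pair ℝ y z
    rw [collinear_iff_of_mem (p₀ := x) (by simp)]
    refine ⟨y - x, ?_⟩
    simp only [mem_insert_iff, mem_singleton_iff, forall_eq_or_imp, forall_eq, vadd_eq_add]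
    refine ⟨⟨0, by simp⟩, ⟨1, by simp⟩, ?_⟩
    simp only [orient] at h
    by_cases h1 : y.1 - x.1 = 0
    · have h2 : y.2 - x.2 ≠ 0 := fun h2 => hxy (Prod.ext (by linarith) (by linarith))
      refine ⟨(z.2 - x.2) / (y.2 - x.2), Prod.ext ?_ ?_⟩
      · simp only [Prod.fst_add, Prod.smul_fst, Prod.fst_sub, smul_eq_mul]
        field_simp; linarith
      · simp only [Prod.snd_add, Prod.smul_snd, Prod.snd_sub, smul_eq_mul]
        field_simp; ring
    · refine ⟨(z.1 - x.1) / (y.1 - x.1), Prod.ext ?_ ?_⟩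
      · simp only [Prod.fst_add, Prod.smul_fst, Prod.fst_sub, smul_eq_mul]
        field_simp; ring
      · simp only [Prod.snd_add, Prod.smul_snd, Prod.snd_sub, smul_eq_mul]
        field_simp; linarith
  rcases hcol.wbtw_or_wbtw_or_wbtw with h | h | h
  · exact .inr (.inl (segment_symm ℝ x z ▸ mem_segment_iff_wbtw.2 h))
  · exact .inr (.inr (segment_symm ℝ y x ▸ mem_segment_iff_wbtw.2 h))
  · exact .inl (segment_symm ℝ z y ▸ mem_segment_iff_wbtw.2 h)

namespace StraightDrawing

variable {V : Type} {G : SimpleGraph V} {Γ : StraightDrawing G}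

lemma IsPlanar.pos_notMem (hΓ : Γ.IsPlanar) {x y w : V} (h : G.Adj x y) (hx : w ≠ x)
    (hy : w ≠ y) : Γ.pos w ∉ segment ℝ (Γ.pos x) (Γ.pos y) :=
  hΓ.1 w s(x, y) h (by simp [hx, hy])

lemma IsPlanar.disjoint (hΓ : Γ.IsPlanar) {x y z w : V} (h : G.Adj x y) (h' : G.Adj z w)
    (hxz : x ≠ z) (hxw : x ≠ w) (hyz : y ≠ z) (hyw : y ≠ w) :
    Disjoint (segment ℝ (Γ.pos x) (Γ.pos y)) (segment ℝ (Γ.pos z) (Γ.pos w)) := by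
  rw [Set.disjoint_left]
  intro p hp hp'
  obtain ⟨t, ht, ht', -⟩ := hΓ.2 s(x, y) h s(z, w) h' (by simp [hxz, hxw]) p ⟨hp, hp'⟩
  simp only [Sym2.mem_iff] at ht ht'
  rcases ht with rfl | rfl <;> rcases ht' with rfl | rfl <;> contradiction

lemma IsPlanar.orient_ne_zero (hΓ : Γ.IsPlanar) {x y z : V} (hxy : G.Adj x y) (hyz : G.Adj y z)
    (hzx : G.Adj z x) : orient (Γ.pos x) (Γ.pos y) (Γ.pos z) ≠ 0 := by
  intro h
  rcases mem_segment_of_orient_eq_zero' h with h | h | h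
  · exact hΓ.pos_notMem hyz hxy.ne hzx.ne' h
  · exact hΓ.pos_notMem hzx hyz.ne hxy.ne' h
  · exact hΓ.pos_notMem hxy hzx.ne hyz.ne' h

/-- The point of `p` lies in the open triangle spanned by the points of `x`, `y`, `z`. -/
def Inside (Γ : StraightDrawing G) (x y z p : V) : Prop :=
  InTri (Γ.pos x) (Γ.pos y) (Γ.pos z) (Γ.pos p)

lemma Inside.ne {x y z p : V} (h : Γ.Inside x y z p) : p ≠ x ∧ p ≠ y ∧ p ≠ z := by
  refine ⟨?_, ?_, ?_⟩ <;> rintro rfl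
  · have := h.2.2
    simp [orient] at this
  · have := h.2.2
    rw [show orient (Γ.pos x) (Γ.pos p) (Γ.pos p) = 0 by simp only [orient]; ring] at this
    simp at this
  · have := h.1
    rw [show orient (Γ.pos y) (Γ.pos p) (Γ.pos p) = 0 by simp only [orient]; ring] at this
    simp at this

/-- A neighbour of a vertex inside a triangle of the graph is a corner or inside as well. -/
lemma IsPlanar.inside_of_adj (hΓ : Γ.IsPlanar) {x y z p w : V} (hxy : G.Adj x y)
    (hyz : G.Adj y z) (hzx : G.Adj z x) (hpw : G.Adj p w) (hwx : w ≠ x) (hwy : w ≠ y)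
    (hwz : w ≠ z) (hp : Γ.Inside x y z p) : Γ.Inside x y z w := by
  obtain ⟨hpx, hpy, hpz⟩ := hp.ne
  by_contra hw
  obtain ⟨q, hq, h | h | h⟩ := InTri.exit hp hw
  · exact Set.disjoint_left.1 (hΓ.disjoint hpw hxy hpx hpy hwx hwy) hq h
  · exact Set.disjoint_left.1 (hΓ.disjoint hpw hyz hpy hpz hwy hwz) hq h
  · exact Set.disjoint_left.1 (hΓ.disjoint hpw hzx hpz hpx hwz hwx) hq h

/-- Two triangles over the same base with apexes on the same side are nested. -/
lemma IsPlanar.inside_or_inside (hΓ : Γ.IsPlanar) {x y p q : V} (hxy : x ≠ y)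
    (hxp : G.Adj x p) (hyp : G.Adj y p) (hxq : G.Adj x q) (hyq : G.Adj y q) (hpq : p ≠ q)
    (hs : 0 < orient (Γ.pos x) (Γ.pos y) (Γ.pos p) * orient (Γ.pos x) (Γ.pos y) (Γ.pos q)) :
    Γ.Inside x y q p ∨ Γ.Inside x y p q :=
  inTri_or_inTri hs (hΓ.disjoint hxp hyq hxy hxq.ne hyp.ne' hpq)
    (hΓ.disjoint hyp hxq hxy.symm hyq.ne hxp.ne' hpq)
    (hΓ.pos_notMem hxq hxp.ne' hpq) (hΓ.pos_notMem hyq hyp.ne' hpq)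
    (hΓ.pos_notMem hxp hxq.ne' hpq.symm) (hΓ.pos_notMem hyp hyq.ne' hpq.symm)

/-- If `p` is inside the triangle `x y z` and joined to its corners, then a further common
neighbour `b` of `x`, `p`, `z` lies inside the triangle `x z p`. -/
lemma IsPlanar.inside_of_common_neighbor (hΓ : Γ.IsPlanar) {x y z p b : V} (hxy : G.Adj x y)
    (hyz : G.Adj y z) (hzx : G.Adj z x) (hxp : G.Adj x p) (hyp : G.Adj y p) (hzp : G.Adj z p)
    (hbx : G.Adj b x) (hbp : G.Adj b p) (hbz : G.Adj b z) (hby : b ≠ y)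
    (hp : Γ.Inside x y z p) : Γ.Inside x z p b := by
  have hb := hΓ.inside_of_adj hxy hyz hzx hbp.symm hbx.ne hby hbz.ne hp
  have hs : 0 < orient (Γ.pos x) (Γ.pos z) (Γ.pos p) * orient (Γ.pos x) (Γ.pos z) (Γ.pos b) := by
    have h := mul_pos hp.2.1 hb.2.1
    rw [orient_swap (Γ.pos z), orient_swap (Γ.pos z)]
    have h0 : 0 < orient (Γ.pos x) (Γ.pos y) (Γ.pos z) ^ 2 := by
      have := InTri.orient_ne_zero hp
      positivity
    refine pos_of_mul_pos_left (b := orient (Γ.pos x) (Γ.pos y) (Γ.pos z) ^ 2) ?_ h0.le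
    linarith
  rcases hΓ.inside_or_inside hzx.ne' hxp hzp hbx.symm hbz.symm hbp.ne' hs with h | h
  · have hy := hΓ.inside_of_adj hzx.symm hbz.symm hbx hyp.symm hxy.ne' hyz.ne hby.symm h
    exact absurd hy hb.rotate.rotate.swap.not_symm
  · exact h

end StraightDrawing

/-- A fan: a path `f 0, …, f n` joined to the two adjacent vertices `u` and `v`, such that each
edge of the path has a further common neighbour with `u` and one with `v`. -/
structure IsFan {V : Type} (G : SimpleGraph V) (u v : V) (f : ℕ → V) (n : ℕ) : Prop where
  adj_base : G.Adj u v
  adj_left : ∀ j ≤ n, G.Adj u (f j)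
  adj_right : ∀ j ≤ n, G.Adj v (f j)
  adj_succ : ∀ j < n, G.Adj (f j) (f (j + 1))
  inj : ∀ i ≤ n, ∀ j ≤ n, f i = f j → i = j
  left : ∀ j < n, ∃ b ≠ v, G.Adj b u ∧ G.Adj b (f j) ∧ G.Adj b (f (j + 1))
  right : ∀ j < n, ∃ c ≠ u, G.Adj c v ∧ G.Adj c (f j) ∧ G.Adj c (f (j + 1))

namespace IsFan

variable {V : Type} {G : SimpleGraph V} {Γ : StraightDrawing G} {u v : V} {f : ℕ → V} {n : ℕ}

lemma reverse (h : IsFan G u v f n) : IsFan G u v (fun j => f (n - j)) n where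
  adj_base := h.adj_base
  adj_left j _ := h.adj_left _ (Nat.sub_le n j)
  adj_right j _ := h.adj_right _ (Nat.sub_le n j)
  adj_succ j hj := by
    have := h.adj_succ (n - (j + 1)) (by omega)
    rw [show n - (j + 1) + 1 = n - j by omega] at this
    exact this.symm
  inj i hi j hj hij := by
    have := h.inj _ (Nat.sub_le n i) _ (Nat.sub_le n j) hij
    omega
  left j hj := by
    obtain ⟨b, hb, h1, h2, h3⟩ := h.left (n - (j + 1)) (by omega)
    rw [show n - (j + 1) + 1 = n - j by omega] at h3
    exact ⟨b, hb, h1, h3, h2⟩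
  right j hj := by
    obtain ⟨b, hb, h1, h2, h3⟩ := h.right (n - (j + 1)) (by omega)
    rw [show n - (j + 1) + 1 = n - j by omega] at h3
    exact ⟨b, hb, h1, h3, h2⟩

lemma mono (h : IsFan G u v f n) {m : ℕ} (hm : m ≤ n) : IsFan G u v f m where
  adj_base := h.adj_base
  adj_left j hj := h.adj_left j (hj.trans hm)
  adj_right j hj := h.adj_right j (hj.trans hm)
  adj_succ j hj := h.adj_succ j (hj.trans_le hm)
  inj i hi j hj := h.inj i (hi.trans hm) j (hj.trans hm)
  left j hj := h.left j (hj.trans_le hm)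
  right j hj := h.right j (hj.trans_le hm)

/-- The side of the line through `u` and `v` on which `f j` lies. -/
noncomputable def side (Γ : StraightDrawing G) (u v : V) (f : ℕ → V) (j : ℕ) : ℝ :=
  orient (Γ.pos u) (Γ.pos v) (Γ.pos (f j))

lemma side_ne_zero (h : IsFan G u v f n) (hΓ : Γ.IsPlanar) {j : ℕ} (hj : j ≤ n) :
    side Γ u v f j ≠ 0 :=
  hΓ.orient_ne_zero h.adj_base (h.adj_right j hj) (h.adj_left j hj).symm

lemma nested (h : IsFan G u v f n) (hΓ : Γ.IsPlanar) {i j : ℕ} (hi : i ≤ n) (hj : j ≤ n)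
    (hij : i ≠ j) (hs : 0 < side Γ u v f i * side Γ u v f j) :
    Γ.Inside u v (f j) (f i) ∨ Γ.Inside u v (f i) (f j) :=
  hΓ.inside_or_inside h.adj_base.ne (h.adj_left i hi) (h.adj_right i hi) (h.adj_left j hj)
    (h.adj_right j hj) (fun e => hij (h.inj i hi j hj e)) hs

lemma inside_of_adj (h : IsFan G u v f n) (hΓ : Γ.IsPlanar) {i j k : ℕ} (hj : j ≤ n) (hk : k ≤ n)
    (hkj : k ≠ j) (hadj : G.Adj (f i) (f k)) (hi : Γ.Inside u v (f j) (f i)) :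
    Γ.Inside u v (f j) (f k) :=
  hΓ.inside_of_adj h.adj_base (h.adj_right j hj) (h.adj_left j hj).symm hadj
    (h.adj_left k hk).ne' (h.adj_right k hk).ne' (fun e => hkj (h.inj k hk j hj e)) hi

/-- Nesting propagates towards the inside. -/
lemma inside_pred (h : IsFan G u v f n) (hΓ : Γ.IsPlanar) {j : ℕ} (hj : j + 2 ≤ n)
    (hin : Γ.Inside u v (f (j + 2)) (f (j + 1))) : Γ.Inside u v (f (j + 1)) (f j) := by
  have hadj := h.adj_succ j (by omega)
  have hadj' := h.adj_succ (j + 1) (by omega)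
  have h2 := h.inside_of_adj hΓ hj (by omega) (k := j) (by omega) hadj.symm hin
  have hs : 0 < side Γ u v f j * side Γ u v f (j + 1) := by
    have h3 := mul_pos h2.same_side hin.same_side
    have h0 : 0 < side Γ u v f (j + 2) ^ 2 := by
      have := h.side_ne_zero hΓ hj
      positivity
    refine pos_of_mul_pos_left (b := side Γ u v f (j + 2) ^ 2) ?_ h0.le
    simp only [side] at *
    linarith
  rcases h.nested hΓ (by omega) (by omega) (by omega) hs with h3 | h3
  · exact h3
  · exact absurd (h.inside_of_adj hΓ (by omega) hj (by omega) hadj' h3) h2.not_symm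

lemma inside_of_inside (h : IsFan G u v f n) (hΓ : Γ.IsPlanar) {m : ℕ} (hm : m + 1 ≤ n)
    (hin : Γ.Inside u v (f (m + 1)) (f m)) {j : ℕ} (hj : j ≤ m) :
    Γ.Inside u v (f (j + 1)) (f j) := by
  induction hj using Nat.decreasingInduction with
  | self => exact hin
  | of_succ k hk ih => exact h.inside_pred hΓ (by omega) ih

/-- Nesting propagates towards the outside, unless the line through `u` and `v` is crossed. -/
lemma inside_succ (h : IsFan G u v f n) (hΓ : Γ.IsPlanar) {j : ℕ} (hj : j + 2 ≤ n)
    (hs : 0 < side Γ u v f (j + 1) * side Γ u v f (j + 2))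
    (hin : Γ.Inside u v (f (j + 1)) (f j)) : Γ.Inside u v (f (j + 2)) (f (j + 1)) := by
  rcases h.nested hΓ (by omega) hj (by omega) hs with h1 | h1
  · exact h1
  have hadj := h.adj_succ j (by omega)
  have hadj' := h.adj_succ (j + 1) (by omega)
  have hs' : 0 < side Γ u v f j * side Γ u v f (j + 2) := by
    have h3 := mul_pos h1.same_side hin.same_side
    have h0 : 0 < side Γ u v f (j + 1) ^ 2 := by
      have := h.side_ne_zero hΓ (j := j + 1) (by omega)
      positivity
    refine pos_of_mul_pos_left (b := side Γ u v f (j + 1) ^ 2) ?_ h0.le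
    simp only [side] at *
    linarith
  rcases h.nested hΓ (by omega) hj (by omega) hs' with h2 | h2
  · exact absurd (h.inside_of_adj hΓ hj (by omega) (by omega) hadj h2) h1.not_symm
  · exact absurd (h.inside_of_adj hΓ (by omega) (by omega) (by omega) hadj'.symm h2) hin.not_symm

/-- If consecutive path vertices lie on different sides of the line through `u` and `v`, then
the triangles before the crossing are nested. -/
lemma inside_of_crossing (h : IsFan G u v f n) (hΓ : Γ.IsPlanar) {j : ℕ} (hj : j + 2 ≤ n)
    (hs : side Γ u v f (j + 1) * side Γ u v f (j + 2) < 0) :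
    Γ.Inside u v (f (j + 1)) (f j) := by
  have hadj := h.adj_succ j (by omega)
  have hadj' := h.adj_succ (j + 1) (by omega)
  have n0 := h.side_ne_zero hΓ (j := j) (by omega)
  have same : 0 < side Γ u v f j * side Γ u v f (j + 1) := by
    by_contra hc
    have hs' : 0 < side Γ u v f j * side Γ u v f (j + 2) := by
      have n1 := h.side_ne_zero hΓ (j := j + 1) (by omega)
      have hc' : side Γ u v f j * side Γ u v f (j + 1) < 0 :=
        lt_of_le_of_ne (not_lt.1 hc) (mul_ne_zero n0 n1)
      have h0 : 0 < side Γ u v f (j + 1) ^ 2 := by positivity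
      refine pos_of_mul_pos_left (b := side Γ u v f (j + 1) ^ 2) ?_ h0.le
      nlinarith [mul_pos_of_neg_of_neg hs hc']
    rcases h.nested hΓ (by omega) hj (by omega) hs' with h2 | h2
    · have := h.inside_of_adj hΓ hj (by omega) (by omega) hadj h2
      exact lt_asymm hs this.same_side
    · have := h.inside_of_adj hΓ (k := j + 1) (by omega) (by omega) (by omega) hadj'.symm h2
      exact hc (by rw [mul_comm]; exact this.same_side)
  rcases h.nested hΓ (by omega) (by omega) (by omega) same with h1 | h1
  · exact h1
  · have := (h.inside_of_adj hΓ (by omega) hj (by omega) hadj' h1).same_side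
    have h0 : 0 < side Γ u v f (j + 1) ^ 2 := by
      have := h.side_ne_zero hΓ (j := j + 1) (by omega)
      positivity
    have h2 := mul_pos_of_neg_of_neg hs (neg_neg_of_pos same)
    change 0 < side Γ u v f (j + 2) * side Γ u v f j at this
    nlinarith


/-- The row of a point in an open triangle is strictly between the extreme rows of its corners. -/
lemma _root_.InTri.row {x y z p : Pt} (h : InTri x y z p) {a b c k : ℤ} (hx : x.2 = a)
    (hy : y.2 = b) (hz : z.2 = c) (hp : p.2 = k) :
    (a < k ∨ b < k ∨ c < k) ∧ (k < a ∨ k < b ∨ k < c) := by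
  obtain ⟨α, β, γ, hα, hβ, hγ, hsum, hpe, ho⟩ := h.exists_weights
  have h0 := h.orient_ne_zero
  have hk : (k : ℝ) = α * a + β * b + γ * c := by
    rw [← hx, ← hy, ← hz, ← hp, hpe]; simp
  have hflat : ¬ (a = k ∧ b = k ∧ c = k) := by
    rintro ⟨rfl, rfl, rfl⟩
    exact h0 (by simp only [orient, hx, hy, hz]; ring)
  have hd : α * ((a : ℝ) - k) + β * (b - k) + γ * (c - k) = 0 := by
    linear_combination -hk - (k : ℝ) * hsum
  constructor
  · by_contra! hc
    obtain ⟨h1, h2, h3⟩ := hc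
    have h1' : (0 : ℝ) ≤ a - k := by exact_mod_cast sub_nonneg.2 h1
    have h2' : (0 : ℝ) ≤ b - k := by exact_mod_cast sub_nonneg.2 h2
    have h3' : (0 : ℝ) ≤ c - k := by exact_mod_cast sub_nonneg.2 h3
    have m1 := mul_nonneg hα.le h1'
    have m2 := mul_nonneg hβ.le h2'
    have m3 := mul_nonneg hγ.le h3'
    have z1 : α * ((a : ℝ) - k) = 0 := by linarith
    have z2 : β * ((b : ℝ) - k) = 0 := by linarith
    have z3 : γ * ((c : ℝ) - k) = 0 := by linarith
    simp only [mul_eq_zero, hα.ne', hβ.ne', hγ.ne', false_or, sub_eq_zero, Int.cast_inj] at z1 z2 z3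
    exact hflat ⟨z1, z2, z3⟩
  · by_contra! hc
    obtain ⟨h1, h2, h3⟩ := hc
    have h1' : (a : ℝ) - k ≤ 0 := by exact_mod_cast sub_nonpos.2 h1
    have h2' : (b : ℝ) - k ≤ 0 := by exact_mod_cast sub_nonpos.2 h2
    have h3' : (c : ℝ) - k ≤ 0 := by exact_mod_cast sub_nonpos.2 h3
    have m1 := mul_nonpos_of_nonneg_of_nonpos hα.le h1'
    have m2 := mul_nonpos_of_nonneg_of_nonpos hβ.le h2'
    have m3 := mul_nonpos_of_nonneg_of_nonpos hγ.le h3'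
    have z1 : α * ((a : ℝ) - k) = 0 := by linarith
    have z2 : β * ((b : ℝ) - k) = 0 := by linarith
    have z3 : γ * ((c : ℝ) - k) = 0 := by linarith
    simp only [mul_eq_zero, hα.ne', hβ.ne', hγ.ne', false_or, sub_eq_zero, Int.cast_inj] at z1 z2 z3
    exact hflat ⟨z1, z2, z3⟩

/-- Rows of two consecutive nested triangles of a fan. -/
lemma rows_of_inside (h : IsFan G u v f n) (hΓ : Γ.IsPlanar) {row : V → ℤ}
    (hrow : ∀ w, 1 ≤ row w ∧ row w ≤ 4 ∧ (Γ.pos w).2 = row w) {j : ℕ} (hj : j < n)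
    (hin : Γ.Inside u v (f (j + 1)) (f j)) :
    (row (f j) = 2 ∨ row (f j) = 3) ∧
    (∃ k, (row u < k ∨ row (f (j + 1)) < k ∨ row (f j) < k) ∧
      (k < row u ∨ k < row (f (j + 1)) ∨ k < row (f j))) ∧
    ∃ k, (row v < k ∨ row (f (j + 1)) < k ∨ row (f j) < k) ∧
      (k < row v ∨ k < row (f (j + 1)) ∨ k < row (f j)) := by
  have hr : ∀ w, (Γ.pos w).2 = row w := fun w => (hrow w).2.2
  have hadj := h.adj_succ j hj
  have hu := h.adj_left j (by omega)
  have hv := h.adj_right j (by omega)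
  have hu' := h.adj_left (j + 1) (by omega)
  have hv' := h.adj_right (j + 1) (by omega)
  obtain ⟨b, hbv, hbu, hb, hb'⟩ := h.left j hj
  obtain ⟨c, hcu, hcv, hc, hc'⟩ := h.right j hj
  have hbin := hΓ.inside_of_common_neighbor h.adj_base hv' hu'.symm hu hv hadj.symm hbu hb hb'
    hbv hin
  have hcin := hΓ.inside_of_common_neighbor h.adj_base.symm hu' hv'.symm hv hu hadj.symm hcv hc
    hc' hcu hin.swap
  have h0 := InTri.row hin (hr _) (hr _) (hr _) (hr _)
  refine ⟨?_, ⟨row b, InTri.row hbin (hr _) (hr _) (hr _) (hr _)⟩,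
    ⟨row c, InTri.row hcin (hr _) (hr _) (hr _) (hr _)⟩⟩
  have := hrow u
  have := hrow v
  have := hrow (f j)
  have := hrow (f (j + 1))
  omega

/-- Three nested steps of a fan force its base to span all four rows. -/
lemma base_rows (h : IsFan G u v f n) (hΓ : Γ.IsPlanar) {row : V → ℤ}
    (hrow : ∀ w, 1 ≤ row w ∧ row w ≤ 4 ∧ (Γ.pos w).2 = row w) (hn : 3 ≤ n)
    (hin : ∀ j < n, Γ.Inside u v (f (j + 1)) (f j)) :
    (row u = 1 ∧ row v = 4) ∨ (row u = 4 ∧ row v = 1) := by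
  obtain ⟨r0, ⟨k0, h0⟩, ⟨l0, h0'⟩⟩ := h.rows_of_inside hΓ hrow (j := 0) (by omega) (hin _ (by omega))
  obtain ⟨r1, ⟨k1, h1⟩, ⟨l1, h1'⟩⟩ := h.rows_of_inside hΓ hrow (j := 1) (by omega) (hin _ (by omega))
  obtain ⟨r2, -, -⟩ := h.rows_of_inside hΓ hrow (j := 2) (by omega) (hin _ (by omega))
  have hr : ∀ w, (Γ.pos w).2 = row w := fun w => (hrow w).2.2
  have i0 := InTri.row (hin 0 (by omega)) (hr _) (hr _) (hr _) (hr _)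
  have i1 := InTri.row (hin 1 (by omega)) (hr _) (hr _) (hr _) (hr _)
  have := hrow u
  have := hrow v
  simp only [zero_add, Nat.reduceAdd] at *
  omega

lemma abs_side_lt (h : IsFan G u v f n) (hΓ : Γ.IsPlanar) {row : V → ℤ}
    (hrow : ∀ w, 1 ≤ row w ∧ row w ≤ 4 ∧ (Γ.pos w).2 = row w)
    (hbase : (row u = 1 ∧ row v = 4) ∨ (row u = 4 ∧ row v = 1)) {j : ℕ} (hj : j < n)
    (hin : Γ.Inside u v (f (j + 1)) (f j)) :
    2 * |side Γ u v f j| < |side Γ u v f (j + 1)| := by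
  obtain ⟨hr, ⟨k, hk⟩, ⟨l, hl⟩⟩ := h.rows_of_inside hΓ hrow hj hin
  have hr' : row (f j) = 2 ∧ (row (f (j + 1)) = 3 ∨ row (f (j + 1)) = 4) ∨
      row (f j) = 3 ∧ (row (f (j + 1)) = 1 ∨ row (f (j + 1)) = 2) := by
    have := hrow (f (j + 1))
    omega
  obtain ⟨α, β, γ, hα, hβ, hγ, hsum, hp, ho⟩ := InTri.exists_weights hin
  have hp2 : (row (f j) : ℝ) = α * row u + β * row v + γ * row (f (j + 1)) := by
    simp only [← fun w => (hrow w).2.2]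
    rw [hp]; simp
  have hγ' : γ < 1 / 2 := by
    rcases hbase with ⟨e1, e2⟩ | ⟨e1, e2⟩ <;> rcases hr' with ⟨e3, e4 | e4⟩ | ⟨e3, e4 | e4⟩ <;>
      rw [e1, e2, e3, e4] at hp2 <;> push_cast at hp2 <;> linarith
  have hpos := abs_pos.2 (h.side_ne_zero hΓ (j := j + 1) (by omega))
  change side Γ u v f j = γ * side Γ u v f (j + 1) at ho
  rw [ho, abs_mul, abs_of_pos hγ]
  nlinarith

lemma le_abs_side (h : IsFan G u v f n) (hΓ : Γ.IsPlanar) (hgrid : Γ.IsGrid) {row : V → ℤ}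
    (hrow : ∀ w, 1 ≤ row w ∧ row w ≤ 4 ∧ (Γ.pos w).2 = row w)
    (hbase : (row u = 1 ∧ row v = 4) ∨ (row u = 4 ∧ row v = 1))
    (hin : ∀ j < n, Γ.Inside u v (f (j + 1)) (f j)) {j : ℕ} (hj : j ≤ n) :
    (2 : ℝ) ^ (j + 1) - 1 ≤ |side Γ u v f j| := by
  have hint : ∀ j, ∃ k : ℤ, |side Γ u v f j| = k := by
    intro j
    obtain ⟨p, hp⟩ := hgrid u
    obtain ⟨q, hq⟩ := hgrid v
    obtain ⟨r, hr⟩ := hgrid (f j)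
    refine ⟨|(q.1 - p.1) * (r.2 - p.2) - (q.2 - p.2) * (r.1 - p.1)|, ?_⟩
    simp only [side, orient, hp, hq, hr]
    push_cast
    rfl
  induction j with
  | zero =>
    obtain ⟨k, hk⟩ := hint 0
    have hpos := abs_pos.2 (h.side_ne_zero hΓ (j := 0) (by omega))
    rw [hk] at hpos ⊢
    have : (1 : ℤ) ≤ k := by exact_mod_cast hpos
    have : (1 : ℝ) ≤ k := by exact_mod_cast this
    norm_num; exact this
  | succ j ih =>
    have ih := ih (by omega)
    have hlt := h.abs_side_lt hΓ hrow hbase (by omega) (hin j (by omega))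
    obtain ⟨k, hk⟩ := hint j
    obtain ⟨l, hl⟩ := hint (j + 1)
    rw [hk] at ih hlt
    rw [hl] at hlt ⊢
    have : 2 * k + 1 ≤ l := by exact_mod_cast hlt
    have : 2 * (k : ℝ) + 1 ≤ l := by exact_mod_cast this
    rw [pow_succ]
    linarith

lemma width_of_inside (h : IsFan G u v f n) (hΓ : Γ.IsPlanar) (hgrid : Γ.IsGrid) {row : V → ℤ}
    (hrow : ∀ w, 1 ≤ row w ∧ row w ≤ 4 ∧ (Γ.pos w).2 = row w) (hn : 3 ≤ n)
    (hin : ∀ j < n, Γ.Inside u v (f (j + 1)) (f j)) :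
    ∃ w₁ w₂ : V, (2 : ℝ) ^ (n + 1) / 3 ≤ (Γ.pos w₁).1 - (Γ.pos w₂).1 + 1 := by
  have hbase := h.base_rows hΓ hrow hn hin
  have hle := h.le_abs_side hΓ hgrid hrow hbase hin le_rfl
  by_contra! hc
  have c1 := hc u (f n)
  have c2 := hc v (f n)
  have c3 := hc (f n) u
  have c4 := hc (f n) v
  obtain ⟨h1, h2, hr⟩ := hrow (f n)
  simp only [side, orient, hr, (hrow u).2.2, (hrow v).2.2] at hle
  generalize row (f n) = r at *
  rcases hbase with ⟨e1, e2⟩ | ⟨e1, e2⟩ <;> rw [e1, e2] at hle <;>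
    rcases le_abs'.1 hle with hle | hle <;> interval_cases r <;> push_cast at hle <;> linarith

lemma _root_.mem_segment_of_row {x y q : Pt} (hxy : x.2 < y.2) (h : orient x y q = 0)
    (h₁ : x.2 ≤ q.2) (h₂ : q.2 ≤ y.2) : q ∈ segment ℝ x y := by
  have h0 : 0 < y.2 - x.2 := by linarith
  refine ⟨(y.2 - q.2) / (y.2 - x.2), (q.2 - x.2) / (y.2 - x.2), by
    apply div_nonneg <;> linarith, by apply div_nonneg <;> linarith, by field_simp; ring, ?_⟩
  simp only [orient] at h
  ext
  · simp only [Prod.fst_add, Prod.smul_fst, smul_eq_mul]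
    field_simp; linarith
  · simp only [Prod.snd_add, Prod.smul_snd, smul_eq_mul]
    field_simp; ring

lemma _root_.exists_orient_eq_zero {x y p q : Pt} (h : orient x y p * orient x y q < 0) :
    ∃ z ∈ segment ℝ p q, orient x y z = 0 := by
  set a := orient x y p with ha
  set b := orient x y q with hb
  have hne : a - b ≠ 0 := by
    intro h0
    have : a = b := by linarith
    rw [this] at h
    nlinarith
  have h2 : 0 < (a - b) ^ 2 := by positivity
  have e1 : -b / (a - b) = (b ^ 2 - a * b) / (a - b) ^ 2 := by field_simp; ring
  have e2 : a / (a - b) = (a ^ 2 - a * b) / (a - b) ^ 2 := by field_simp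
  refine ⟨(1 - a / (a - b)) • p + (a / (a - b)) • q, ⟨_, _, ?_, ?_, by ring, rfl⟩, ?_⟩
  · rw [show 1 - a / (a - b) = -b / (a - b) by field_simp; ring, e1]
    exact div_nonneg (by nlinarith [sq_nonneg b]) h2.le
  · rw [e2]
    exact div_nonneg (by nlinarith [sq_nonneg a]) h2.le
  · rw [orient_lineMap, ← ha, ← hb]
    field_simp; ring

lemma not_crossing (h : IsFan G u v f n) (hΓ : Γ.IsPlanar) {row : V → ℤ}
    (hrow : ∀ w, 1 ≤ row w ∧ row w ≤ 4 ∧ (Γ.pos w).2 = row w) {i : ℕ} (hi : 3 ≤ i) (hin : i < n) :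
    ¬ side Γ u v f i * side Γ u v f (i + 1) < 0 := by
  intro hs
  obtain ⟨m, rfl⟩ : ∃ m, i = m + 1 := ⟨i - 1, by omega⟩
  have hm := h.inside_of_crossing hΓ (by omega) hs
  have hbase := (h.mono hin.le).base_rows hΓ hrow hi
    (fun j hj => h.inside_of_inside hΓ (by omega) hm (by omega))
  obtain ⟨z, hz, h0⟩ := exists_orient_eq_zero hs
  have hrows : 1 ≤ z.2 ∧ z.2 ≤ 4 := by
    have hconv : Convex ℝ {p : Pt | 1 ≤ p.2 ∧ p.2 ≤ 4} :=
      (convex_Icc (1 : ℝ) 4).linear_preimage (LinearMap.snd ℝ ℝ ℝ)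
    have hmem : ∀ w, Γ.pos w ∈ {p : Pt | 1 ≤ p.2 ∧ p.2 ≤ 4} := by
      intro w
      obtain ⟨h1, h2, h3⟩ := hrow w
      rw [Set.mem_ofPred_eq, h3]
      exact ⟨by exact_mod_cast h1, by exact_mod_cast h2⟩
    exact hconv.segment_subset (hmem _) (hmem _) hz
  have hmem : z ∈ segment ℝ (Γ.pos u) (Γ.pos v) := by
    have hu := (hrow u).2.2
    have hv := (hrow v).2.2
    rcases hbase with ⟨e1, e2⟩ | ⟨e1, e2⟩ <;> rw [e1] at hu <;> rw [e2] at hv <;>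
      push_cast at hu hv
    · exact mem_segment_of_row (by linarith) h0 (by linarith) (by linarith)
    · rw [segment_symm]
      exact mem_segment_of_row (by linarith) (by rw [orient_swap, h0, neg_zero]) (by linarith)
        (by linarith)
  exact Set.disjoint_left.1 (hΓ.disjoint (h.adj_succ (m + 1) hin) h.adj_base
    (h.adj_left _ hin.le).ne' (h.adj_right _ hin.le).ne' (h.adj_left _ hin).ne'
    (h.adj_right _ hin).ne') hz hmem

/-- A long fan drawn on four rows has exponential width. -/
lemma width (h : IsFan G u v f n) (hΓ : Γ.IsPlanar) (hgrid : Γ.IsGrid) (hheight : Γ.HeightLe 4)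
    (hn : 6 ≤ n) : ∃ w₁ w₂ : V, (2 : ℝ) ^ (n + 1) / 3 ≤ (Γ.pos w₁).1 - (Γ.pos w₂).1 + 1 := by
  choose row hrow using hheight
  have hpos : ∀ i < n, 0 < side Γ u v f i * side Γ u v f (i + 1) := by
    intro i hi
    have hne := mul_ne_zero (h.side_ne_zero hΓ hi.le) (h.side_ne_zero hΓ (j := i + 1) hi)
    refine lt_of_le_of_ne (not_lt.1 fun hneg => ?_) hne.symm
    rcases le_or_gt 3 i with h3 | h3
    · exact h.not_crossing hΓ hrow h3 hi hneg
    · refine h.reverse.not_crossing hΓ hrow (i := n - (i + 1)) (by omega) (by omega) ?_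
      simp only [side]
      rw [show n - (n - (i + 1)) = i + 1 by omega, show n - (n - (i + 1) + 1) = i by omega,
        mul_comm]
      exact hneg
  rcases h.nested hΓ (i := 0) (j := 1) (by omega) (by omega) (by omega) (hpos 0 (by omega))
    with h01 | h10
  · refine h.width_of_inside hΓ hgrid hrow (by omega) fun j hj => ?_
    induction j with
    | zero => exact h01
    | succ j ih => exact h.inside_succ hΓ hj (hpos _ hj) (ih (by omega))
  · refine h.reverse.width_of_inside hΓ hgrid hrow (by omega) fun j hj => ?_
    refine h.reverse.inside_of_inside hΓ (m := n - 1) (by omega) ?_ (by omega)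
    simp only [show n - (n - 1 + 1) = 0 by omega, show n - (n - 1) = 1 by omega]
    exact h10

end IsFan

/-- The vertices `a_0, …, a_{d-1}` as a sequence. -/
def pathSeq (d : ℕ) (j : ℕ) : HVert d := if h : j < d then .a ⟨j, h⟩ else .u

lemma isFan_Hgraph (d : ℕ) (hd : 1 ≤ d) : IsFan (Hgraph d) .u .v (pathSeq d) (d - 1) := by
  have hp : ∀ j, (h : j < d) → pathSeq d j = .a ⟨j, h⟩ := fun j h => by simp [pathSeq, h]
  refine ⟨by simp [Hgraph, HRel], fun j hj => ?_, fun j hj => ?_, fun j hj => ?_,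
    fun i hi j hj hij => ?_, fun j hj => ?_, fun j hj => ?_⟩
  · simp [hp j (by omega), Hgraph, HRel]
  · simp [hp j (by omega), Hgraph, HRel]
  · simp [hp j (by omega), hp (j + 1) (by omega), Hgraph, HRel]
  · simpa [hp i (by omega), hp j (by omega)] using hij
  · exact ⟨.b ⟨j, hj⟩, by simp [hp j (by omega), hp (j + 1) (by omega), Hgraph, HRel]⟩
  · exact ⟨.c ⟨j, hj⟩, by simp [hp j (by omega), hp (j + 1) (by omega), Hgraph, HRel]⟩

lemma StraightDrawing.isPlanar_of_vertex_or_disjoint {V : Type} {G : SimpleGraph V}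
    {Γ : StraightDrawing G}
    (h₁ : ∀ x y w, G.Adj x y → w ≠ x → w ≠ y → Γ.pos w ∉ segment ℝ (Γ.pos x) (Γ.pos y))
    (h₂ : ∀ x y z w, G.Adj x y → G.Adj z w → s(x, y) ≠ s(z, w) →
      ∀ p ∈ segment ℝ (Γ.pos x) (Γ.pos y), p ∈ segment ℝ (Γ.pos z) (Γ.pos w) →
      ∃ t, p = Γ.pos t) : Γ.IsPlanar := by
  have h₁' : ∀ w, ∀ e ∈ G.edgeSet, w ∉ e → Γ.pos w ∉ Γ.edgePts e := by
    intro w e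
    induction e with | _ x y
    intro he hw
    rw [Sym2.mem_iff, not_or] at hw
    exact h₁ x y w he hw.1 hw.2
  refine ⟨h₁', ?_⟩
  intro e he f hf hef p ⟨hpe, hpf⟩
  obtain ⟨t, rfl⟩ : ∃ t, p = Γ.pos t := by
    induction e with | _ x y
    induction f with | _ z w
    exact h₂ x y z w he hf hef p hpe hpf
  exact ⟨t, not_not.1 fun h => h₁' t e he h hpe, not_not.1 fun h => h₁' t f hf h hpf, rfl⟩

/-- Affine functionals on the plane. -/
def IsAff (M : Pt → ℝ) : Prop := ∃ α β γ : ℝ, ∀ p, M p = α * p.1 + β * p.2 + γ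

lemma IsAff.combo {M : Pt → ℝ} (hM : IsAff M) (x y : Pt) {s t : ℝ} (hst : s + t = 1) :
    M (s • x + t • y) = s * M x + t * M y := by
  obtain ⟨α, β, γ, h⟩ := hM
  simp only [h, Prod.fst_add, Prod.snd_add, Prod.smul_fst, Prod.smul_snd, smul_eq_mul]
  linear_combination (-γ) * hst

lemma isAff_orient (x y : Pt) (c : ℝ) : IsAff (fun p => orient x y p * c) :=
  ⟨-(y.2 - x.2) * c, (y.1 - x.1) * c, ((y.2 - x.2) * x.1 - (y.1 - x.1) * x.2) * c, fun p => by
    simp only [orient]; ring⟩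

lemma IsAff.nonneg {M : Pt → ℝ} (hM : IsAff M) {x y p : Pt} (hx : 0 ≤ M x) (hy : 0 ≤ M y)
    (hp : p ∈ segment ℝ x y) : 0 ≤ M p := by
  obtain ⟨s, t, hs, ht, hst, rfl⟩ := hp
  rw [hM.combo x y hst]
  positivity

lemma IsAff.nonpos {M : Pt → ℝ} (hM : IsAff M) {x y p : Pt} (hx : M x ≤ 0) (hy : M y ≤ 0)
    (hp : p ∈ segment ℝ x y) : M p ≤ 0 := by
  obtain ⟨s, t, hs, ht, hst, rfl⟩ := hp
  rw [hM.combo x y hst]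
  nlinarith [mul_nonneg hs (neg_nonneg.2 hx), mul_nonneg ht (neg_nonneg.2 hy)]

lemma IsAff.eq_or_eq {M : Pt → ℝ} (hM : IsAff M) {x y p : Pt} (hx : 0 ≤ M x) (hy : 0 ≤ M y)
    (hxy : 0 < M x ∨ 0 < M y) (hp : p ∈ segment ℝ x y) (h : M p ≤ 0) : p = x ∨ p = y := by
  obtain ⟨s, t, hs, ht, hst, rfl⟩ := hp
  rw [hM.combo x y hst] at h
  have h1 := mul_nonneg hs hx
  have h2 := mul_nonneg ht hy
  rcases hxy with hxy | hxy
  · have : s = 0 := (mul_eq_zero.1 (by linarith : s * M x = 0)).resolve_right hxy.ne'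
    obtain rfl : t = 1 := by linarith
    simp [this]
  · have : t = 0 := (mul_eq_zero.1 (by linarith : t * M y = 0)).resolve_right hxy.ne'
    obtain rfl : s = 1 := by linarith
    simp [this]

lemma orient_eq_zero_of_mem_segment {x y p : Pt} (hp : p ∈ segment ℝ x y) :
    orient x y p = 0 := by
  obtain ⟨s, t, hs, ht, hst, rfl⟩ := hp
  obtain rfl : s = 1 - t := by linarith
  rw [orient_lineMap]
  simp only [orient]; ring

lemma eq_or_eq_of_weakly_separated {x y z w p : Pt}
    (h : 0 ≤ orient x y z * orient x y w) (h' : orient x y z ≠ 0 ∨ orient x y w ≠ 0)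
    (hp : p ∈ segment ℝ x y) (hp' : p ∈ segment ℝ z w) : p = z ∨ p = w := by
  have h0 := orient_eq_zero_of_mem_segment hp
  refine (isAff_orient x y (orient x y z + orient x y w)).eq_or_eq ?_ ?_ ?_ hp' (by simp [h0])
  · nlinarith [sq_nonneg (orient x y z)]
  · nlinarith [sq_nonneg (orient x y w)]
  · refine h'.imp (fun h' => ?_) (fun h' => ?_)
    · have : 0 < orient x y z ^ 2 := by positivity
      nlinarith
    · have : 0 < orient x y w ^ 2 := by positivity
      nlinarith

/-- Grid positions of a drawing of `H_d` on four rows. -/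
def gridPos (d : ℕ) : HVert d → ℤ × ℤ
  | .u => (0, 1)
  | .v => (0, 4)
  | .a i => (2 * 4 ^ (i : ℕ), if Even (i : ℕ) then 2 else 3)
  | .b i => (3 * 4 ^ (i : ℕ), 2)
  | .c i => (3 * 4 ^ (i : ℕ), 3)

lemma four_pow_parity (m n : ℕ) : ((4 : ℤ) ^ m = 4 ^ n ↔ m = n) ∧ (2 * (4 : ℤ) ^ m ≠ 3 * 4 ^ n) := by
  refine ⟨⟨fun h => ?_, fun h => by rw [h]⟩, fun h => ?_⟩
  · exact pow_right_injective₀ (by norm_num : (0 : ℤ) < 4) (by norm_num) h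
  · have h3 : (3 : ℤ) ∣ 2 * 4 ^ m := ⟨_, h⟩
    have hp : Prime (3 : ℤ) := Int.prime_three
    rcases hp.dvd_or_dvd h3 with h3 | h3
    · norm_num at h3
    · have := hp.dvd_of_dvd_pow h3
      norm_num at this

lemma gridPos_injective (d : ℕ) : Function.Injective (gridPos d) := by
  intro x y h
  have h4 : ∀ n : ℕ, (4 : ℤ) ^ n ≠ 0 := fun n => by positivity
  have hp := four_pow_parity
  have hp' : ∀ m n : ℕ, 3 * (4 : ℤ) ^ m ≠ 2 * 4 ^ n := fun m n => ((hp n m).2).symm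
  cases x <;> cases y <;>
    simp_all [gridPos, Prod.ext_iff, (hp _ _).1, (hp _ _).2, Fin.ext_iff]

/-- The drawing of `H_d` given by `gridPos`. -/
noncomputable def gridDrawing (d : ℕ) : StraightDrawing (Hgraph d) where
  pos w := ((gridPos d w).1, (gridPos d w).2)
  pos_inj x y h := by
    simp only [Prod.mk.injEq, Int.cast_inj] at h
    exact gridPos_injective d (Prod.ext h.1 h.2)

/-- The six points of one layer of the drawing, up to scaling and reflection. -/
def layerPt : Fin 6 → ℤ × ℤ := ![(0, 1), (0, 4), (2, 2), (8, 3), (3, 2), (3, 3)]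

/-- The edges added by one layer, as pairs of indices into `layerPt`. -/
def newEdges : List (Fin 6 × Fin 6) :=
  [(2, 3), (0, 3), (1, 3), (4, 0), (4, 2), (4, 3), (5, 1), (5, 2), (5, 3)]

/-- All edges of one layer, including those of the triangle it surrounds. -/
def layerEdges : List (Fin 6 × Fin 6) := (0, 1) :: (0, 2) :: (1, 2) :: newEdges

/-- Integer version of `orient`. -/
def orientInt (p q r : ℤ × ℤ) : ℤ := (q.1 - p.1) * (r.2 - p.2) - (q.2 - p.2) * (r.1 - p.1)

/-- The vertices of the `i`-th layer. -/
def layerVert (d i : ℕ) (hi : i + 1 < d) : Fin 6 → HVert d :=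
  if Even i then ![.u, .v, .a ⟨i, by omega⟩, .a ⟨i + 1, hi⟩, .b ⟨i, by omega⟩, .c ⟨i, by omega⟩]
  else ![.v, .u, .a ⟨i, by omega⟩, .a ⟨i + 1, hi⟩, .c ⟨i, by omega⟩, .b ⟨i, by omega⟩]

/-- Reflection of the rows in the layers of odd index. -/
noncomputable def layerRow (i : ℕ) (y : ℝ) : ℝ := if Even i then y else 5 - y

lemma pos_layerVert (d i : ℕ) (hi : i + 1 < d) (k : Fin 6) :
    (gridDrawing d).pos (layerVert d i hi k) =
      (4 ^ i * ((layerPt k).1 : ℝ), layerRow i (layerPt k).2) := by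
  by_cases h : Even i
  · fin_cases k <;>
      simp [gridDrawing, gridPos, layerVert, layerPt, layerRow, h, Nat.even_add_one,
        pow_succ] <;> ring
  · fin_cases k <;>
      simp [gridDrawing, gridPos, layerVert, layerPt, layerRow, h, Nat.even_add_one,
        pow_succ] <;> first | (constructor <;> ring) | ring

lemma orient_layerVert (d i : ℕ) (hi : i + 1 < d) :
    ∃ c : ℝ, c ≠ 0 ∧ ∀ k l m : Fin 6,
      orient ((gridDrawing d).pos (layerVert d i hi k)) ((gridDrawing d).pos (layerVert d i hi l))
        ((gridDrawing d).pos (layerVert d i hi m)) =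
      c * (orientInt (layerPt k) (layerPt l) (layerPt m) : ℤ) := by
  refine ⟨if Even i then 4 ^ i else -4 ^ i, by split_ifs <;> simp, fun k l m => ?_⟩
  simp only [pos_layerVert, orient, orientInt, layerRow]
  push_cast
  split_ifs <;> ring

/-- Equation of the first leg of the inner triangle of a layer. -/
noncomputable def legA (i : ℕ) (p : Pt) : ℝ := p.1 - 2 * 4 ^ i * (layerRow i p.2 - 1)

/-- Equation of the second leg of the inner triangle of a layer. -/
noncomputable def legB (i : ℕ) (p : Pt) : ℝ := p.1 - 4 ^ i * (4 - layerRow i p.2)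

lemma isAff_legA (i : ℕ) : IsAff (legA i) := by
  by_cases h : Even i
  · exact ⟨1, -2 * 4 ^ i, 2 * 4 ^ i, fun p => by simp only [legA, layerRow, h, if_true]; ring⟩
  · exact ⟨1, 2 * 4 ^ i, -8 * 4 ^ i, fun p => by simp only [legA, layerRow, h, if_false]; ring⟩

lemma isAff_legB (i : ℕ) : IsAff (legB i) := by
  by_cases h : Even i
  · exact ⟨1, 4 ^ i, -4 * 4 ^ i, fun p => by simp only [legB, layerRow, h, if_true]; ring⟩
  · exact ⟨1, -4 ^ i, 4 ^ i, fun p => by simp only [legB, layerRow, h, if_false]; ring⟩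

lemma leg_layerVert (d i : ℕ) (hi : i + 1 < d) (k : Fin 6) :
    legA i ((gridDrawing d).pos (layerVert d i hi k)) =
      4 ^ i * (((layerPt k).1 - 2 * (layerPt k).2 + 2 : ℤ) : ℝ) ∧
    legB i ((gridDrawing d).pos (layerVert d i hi k)) =
      4 ^ i * (((layerPt k).1 + (layerPt k).2 - 4 : ℤ) : ℝ) := by
  simp only [pos_layerVert, legA, legB, layerRow]
  push_cast
  split_ifs <;> constructor <;> ring

lemma leg_neg {i : ℕ} {p : Pt} (hx : p.1 < 4 ^ i) (h2 : 2 ≤ p.2) (h3 : p.2 ≤ 3) :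
    legA i p < 0 ∧ legB i p < 0 := by
  have h4 : (0 : ℝ) < 4 ^ i := by positivity
  have hr : 2 ≤ layerRow i p.2 ∧ layerRow i p.2 ≤ 3 := by
    simp only [layerRow]; split_ifs <;> constructor <;> linarith
  simp only [legA, legB]
  constructor <;> nlinarith

lemma leg_neg_of_index_lt {d i : ℕ} {w : HVert d}
    (hw : (∃ j : Fin d, (j : ℕ) < i ∧ w = .a j) ∨
      (∃ j : Fin (d - 1), (j : ℕ) < i ∧ (w = .b j ∨ w = .c j))) :
    legA i ((gridDrawing d).pos w) < 0 ∧ legB i ((gridDrawing d).pos w) < 0 := by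
  have key : ∀ j < i, (3 : ℝ) * 4 ^ j < 4 ^ i := by
    intro j hj
    have : (4 : ℝ) ^ (j + 1) ≤ 4 ^ i := pow_le_pow_right₀ (by norm_num) hj
    have h0 : (0 : ℝ) < 4 ^ j := by positivity
    rw [pow_succ] at this
    linarith
  rcases hw with ⟨j, hj, rfl⟩ | ⟨j, hj, rfl | rfl⟩ <;> have := key j hj <;>
    have h0 : (0 : ℝ) < 4 ^ (j : ℕ) := by positivity
  · apply leg_neg <;> simp only [gridDrawing, gridPos] <;> push_cast
    · linarith
    · split_ifs <;> norm_num
    · split_ifs <;> norm_num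
  · apply leg_neg <;> simp only [gridDrawing, gridPos] <;> push_cast <;> linarith
  · apply leg_neg <;> simp only [gridDrawing, gridPos] <;> push_cast <;> linarith

lemma layerVert_cases (d i : ℕ) (hi : i + 1 < d) (k : Fin 6) :
    layerVert d i hi k = .u ∨ layerVert d i hi k = .v ∨ layerVert d i hi k = .a ⟨i, by omega⟩ ∨
    layerVert d i hi k = .a ⟨i + 1, hi⟩ ∨ layerVert d i hi k = .b ⟨i, by omega⟩ ∨
    layerVert d i hi k = .c ⟨i, by omega⟩ := by
  by_cases h : Even i <;> fin_cases k <;> simp [layerVert, h]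

lemma exists_layerVert (d i : ℕ) (hi : i + 1 < d) :
    (∃ k ∈ [(0 : Fin 6), 1], layerVert d i hi k = .u) ∧
    (∃ k ∈ [(0 : Fin 6), 1], layerVert d i hi k = .v) ∧
    layerVert d i hi 2 = .a ⟨i, by omega⟩ ∧ layerVert d i hi 3 = .a ⟨i + 1, hi⟩ ∧
    (∃ k, layerVert d i hi k = .b ⟨i, by omega⟩) ∧
    (∃ k, layerVert d i hi k = .c ⟨i, by omega⟩) := by
  by_cases h : Even i
  · exact ⟨⟨0, by simp, by simp [layerVert, h]⟩, ⟨1, by simp, by simp [layerVert, h]⟩,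
      by simp [layerVert, h], by simp [layerVert, h], ⟨4, by simp [layerVert, h]⟩,
      ⟨5, by simp [layerVert, h]⟩⟩
  · exact ⟨⟨1, by simp, by simp [layerVert, h]⟩, ⟨0, by simp, by simp [layerVert, h]⟩,
      by simp [layerVert, h], by simp [layerVert, h], ⟨5, by simp [layerVert, h]⟩,
      ⟨4, by simp [layerVert, h]⟩⟩

lemma leg_nonpos_of_mem (d i : ℕ) (hi : i + 1 < d) {k : Fin 6} (hk : k ∈ [(0 : Fin 6), 1, 2]) :
    legA i ((gridDrawing d).pos (layerVert d i hi k)) ≤ 0 ∧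
    legB i ((gridDrawing d).pos (layerVert d i hi k)) ≤ 0 := by
  rw [(leg_layerVert d i hi k).1, (leg_layerVert d i hi k).2]
  have h4 : (0 : ℝ) < 4 ^ i := by positivity
  have hle : (layerPt k).1 - 2 * (layerPt k).2 + 2 ≤ 0 ∧ (layerPt k).1 + (layerPt k).2 - 4 ≤ 0 := by
    revert k; decide
  exact ⟨mul_nonpos_of_nonneg_of_nonpos h4.le (by exact_mod_cast hle.1),
    mul_nonpos_of_nonneg_of_nonpos h4.le (by exact_mod_cast hle.2)⟩

lemma leg_nonpos_of_lt {d i j : ℕ} (hi : i + 1 < d) (hj : j + 1 < d) (hji : j < i) (k : Fin 6) :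
    legA i ((gridDrawing d).pos (layerVert d j hj k)) ≤ 0 ∧
    legB i ((gridDrawing d).pos (layerVert d j hj k)) ≤ 0 := by
  obtain ⟨⟨ku, hku, hu⟩, ⟨kv, hkv, hv⟩, ha, -⟩ := exists_layerVert d i hi
  rcases layerVert_cases d j hj k with h | h | h | h | h | h <;> rw [h]
  · rw [← hu]; exact leg_nonpos_of_mem d i hi (by clear hu; revert ku; decide)
  · rw [← hv]; exact leg_nonpos_of_mem d i hi (by clear hv; revert kv; decide)
  · exact (leg_neg_of_index_lt (.inl ⟨_, hji, rfl⟩)).imp le_of_lt le_of_lt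
  · rcases Nat.lt_or_ge (j + 1) i with hlt | hge
    · exact (leg_neg_of_index_lt (.inl ⟨_, hlt, rfl⟩)).imp le_of_lt le_of_lt
    · obtain rfl : i = j + 1 := by omega
      rw [← ha]; exact leg_nonpos_of_mem d _ hi (by decide)
  · exact (leg_neg_of_index_lt (.inr ⟨_, hji, .inl rfl⟩)).imp le_of_lt le_of_lt
  · exact (leg_neg_of_index_lt (.inr ⟨_, hji, .inr rfl⟩)).imp le_of_lt le_of_lt

/-- Relative position of a vertex with respect to a layer: in it, inside it, or beyond it. -/
lemma layer_trichotomy (d i : ℕ) (hi : i + 1 < d) (w : HVert d) :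
    (∃ k, w = layerVert d i hi k) ∨
    (0 < i ∧ legA i ((gridDrawing d).pos w) < 0 ∧ legB i ((gridDrawing d).pos w) < 0) ∨
    12 * 4 ^ i ≤ ((gridDrawing d).pos w).1 := by
  obtain ⟨⟨ku, -, hu⟩, ⟨kv, -, hv⟩, ha, ha', ⟨kb, hb⟩, ⟨kc, hc⟩⟩ := exists_layerVert d i hi
  have key : ∀ m n : ℕ, m ≤ n → (4 : ℝ) ^ m ≤ 4 ^ n :=
    fun m n h => pow_le_pow_right₀ (by norm_num) h
  have h0 : (0 : ℝ) < 4 ^ i := by positivity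
  cases w with
  | u => exact .inl ⟨ku, hu.symm⟩
  | v => exact .inl ⟨kv, hv.symm⟩
  | a j =>
    obtain ⟨j, hj⟩ := j
    rcases lt_trichotomy j i with h | rfl | h
    · exact .inr (.inl ⟨by omega, leg_neg_of_index_lt (.inl ⟨_, h, rfl⟩)⟩)
    · exact .inl ⟨2, ha.symm⟩
    · rcases Nat.lt_or_ge (i + 1) j with h' | h'
      · refine .inr (.inr ?_)
        have := key (i + 2) j h'
        rw [pow_add] at this
        simp only [gridDrawing, gridPos]; push_cast
        linarith
      · obtain rfl : j = i + 1 := by omega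
        exact .inl ⟨3, ha'.symm⟩
  | b j =>
    obtain ⟨j, hj⟩ := j
    rcases lt_trichotomy j i with h | rfl | h
    · exact .inr (.inl ⟨by omega, leg_neg_of_index_lt (.inr ⟨_, h, .inl rfl⟩)⟩)
    · exact .inl ⟨kb, hb.symm⟩
    · refine .inr (.inr ?_)
      have := key (i + 1) j h
      rw [pow_add] at this
      simp only [gridDrawing, gridPos]; push_cast
      linarith
  | c j =>
    obtain ⟨j, hj⟩ := j
    rcases lt_trichotomy j i with h | rfl | h
    · exact .inr (.inl ⟨by omega, leg_neg_of_index_lt (.inr ⟨_, h, .inr rfl⟩)⟩)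
    · exact .inl ⟨kc, hc.symm⟩
    · refine .inr (.inr ?_)
      have := key (i + 1) j h
      rw [pow_add] at this
      simp only [gridDrawing, gridPos]; push_cast
      linarith

/-- An edge `x y` of `H_d` drawn in layer `i`, as the pair `k`, `l` of points of that layer. -/
def InLayer (d i : ℕ) (hi : i + 1 < d) (k l : Fin 6) (x y : HVert d) : Prop :=
  (k, l) ∈ layerEdges ∧ (i = 0 ∨ (k, l) ∈ newEdges) ∧
    s(x, y) = s(layerVert d i hi k, layerVert d i hi l)

lemma exists_inLayer_of_rel {d : ℕ} (hd : 2 ≤ d) {x y : HVert d} (h : HRel d x y) :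
    ∃ i hi k l, InLayer d i hi k l x y := by
  cases x with
  | u =>
    cases y with
    | v => exact ⟨0, hd, 0, 1, by decide, by simp, by simp [layerVert]⟩
    | a j =>
      obtain ⟨_ | j, hj⟩ := j
      · exact ⟨0, hd, 0, 2, by decide, by simp, by simp [layerVert]⟩
      · by_cases he : Even j
        · exact ⟨j, hj, 0, 3, by decide, .inr (by decide), by simp [layerVert, he]⟩
        · exact ⟨j, hj, 1, 3, by decide, .inr (by decide), by simp [layerVert, he]⟩
    | _ => simp [HRel] at h
  | v =>
    cases y with
    | a j =>
      obtain ⟨_ | j, hj⟩ := j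
      · exact ⟨0, hd, 1, 2, by decide, by simp, by simp [layerVert]⟩
      · by_cases he : Even j
        · exact ⟨j, hj, 1, 3, by decide, .inr (by decide), by simp [layerVert, he]⟩
        · exact ⟨j, hj, 0, 3, by decide, .inr (by decide), by simp [layerVert, he]⟩
    | _ => simp [HRel] at h
  | a i =>
    cases y with
    | a j =>
      obtain ⟨i, hi⟩ := i
      obtain ⟨j, hj⟩ := j
      obtain rfl : j = i + 1 := h
      exact ⟨i, hj, 2, 3, by decide, .inr (by decide), by simp [layerVert]; split_ifs <;> simp⟩
    | _ => simp [HRel] at h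
  | b i =>
    obtain ⟨i, hi⟩ := i
    cases y with
    | u =>
      by_cases he : Even i
      · exact ⟨i, by omega, 4, 0, by decide, .inr (by decide), by simp [layerVert, he]⟩
      · exact ⟨i, by omega, 5, 1, by decide, .inr (by decide), by simp [layerVert, he]⟩
    | a j =>
      obtain ⟨j, hj⟩ := j
      obtain rfl | rfl : j = i ∨ j = i + 1 := h
      · by_cases he : Even j
        · exact ⟨j, by omega, 4, 2, by decide, .inr (by decide), by simp [layerVert, he]⟩
        · exact ⟨j, by omega, 5, 2, by decide, .inr (by decide), by simp [layerVert, he]⟩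
      · by_cases he : Even i
        · exact ⟨i, by omega, 4, 3, by decide, .inr (by decide), by simp [layerVert, he]⟩
        · exact ⟨i, by omega, 5, 3, by decide, .inr (by decide), by simp [layerVert, he]⟩
    | _ => simp [HRel] at h
  | c i =>
    obtain ⟨i, hi⟩ := i
    cases y with
    | v =>
      by_cases he : Even i
      · exact ⟨i, by omega, 5, 1, by decide, .inr (by decide), by simp [layerVert, he]⟩
      · exact ⟨i, by omega, 4, 0, by decide, .inr (by decide), by simp [layerVert, he]⟩
    | a j =>
      obtain ⟨j, hj⟩ := j
      obtain rfl | rfl : j = i ∨ j = i + 1 := h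
      · by_cases he : Even j
        · exact ⟨j, by omega, 5, 2, by decide, .inr (by decide), by simp [layerVert, he]⟩
        · exact ⟨j, by omega, 4, 2, by decide, .inr (by decide), by simp [layerVert, he]⟩
      · by_cases he : Even i
        · exact ⟨i, by omega, 5, 3, by decide, .inr (by decide), by simp [layerVert, he]⟩
        · exact ⟨i, by omega, 4, 3, by decide, .inr (by decide), by simp [layerVert, he]⟩
    | _ => simp [HRel] at h

lemma exists_inLayer {d : ℕ} (hd : 2 ≤ d) {x y : HVert d} (h : (Hgraph d).Adj x y) :
    ∃ i hi k l, InLayer d i hi k l x y := by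
  rcases ((SimpleGraph.fromRel_adj _ _ _).1 h).2 with h | h
  · exact exists_inLayer_of_rel hd h
  · obtain ⟨i, hi, k, l, h1, h2, h3⟩ := exists_inLayer_of_rel hd h
    exact ⟨i, hi, k, l, h1, h2, by rw [Sym2.eq_swap, h3]⟩

lemma InLayer.segment_eq {d i : ℕ} {hi : i + 1 < d} {k l : Fin 6} {x y : HVert d}
    (h : InLayer d i hi k l x y) :
    segment ℝ ((gridDrawing d).pos x) ((gridDrawing d).pos y) =
      segment ℝ ((gridDrawing d).pos (layerVert d i hi k))
        ((gridDrawing d).pos (layerVert d i hi l)) := by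
  rcases Sym2.eq_iff.1 h.2.2 with ⟨rfl, rfl⟩ | ⟨rfl, rfl⟩
  · rfl
  · rw [segment_symm]

/-- A new edge of a layer lies outside the inner triangle of that layer. -/
lemma exists_leg_nonneg {d i : ℕ} {hi : i + 1 < d} {k l : Fin 6} (h : (k, l) ∈ newEdges) :
    ∃ M, (M = legA i ∨ M = legB i) ∧ IsAff M ∧
      0 ≤ M ((gridDrawing d).pos (layerVert d i hi k)) ∧
      0 ≤ M ((gridDrawing d).pos (layerVert d i hi l)) ∧
      (0 < M ((gridDrawing d).pos (layerVert d i hi k)) ∨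
        0 < M ((gridDrawing d).pos (layerVert d i hi l))) := by
  let mA : Fin 6 → ℤ := fun k => (layerPt k).1 - 2 * (layerPt k).2 + 2
  let mB : Fin 6 → ℤ := fun k => (layerPt k).1 + (layerPt k).2 - 4
  have key : (0 ≤ mA k ∧ 0 ≤ mA l ∧ (0 < mA k ∨ 0 < mA l)) ∨
      (0 ≤ mB k ∧ 0 ≤ mB l ∧ (0 < mB k ∨ 0 < mB l)) := by
    revert k l; decide
  have h4 : (0 : ℝ) < 4 ^ i := by positivity
  have hA := fun k => (leg_layerVert d i hi k).1
  have hB := fun k => (leg_layerVert d i hi k).2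
  rcases key with ⟨h1, h2, h3⟩ | ⟨h1, h2, h3⟩
  · refine ⟨_, .inl rfl, isAff_legA i, ?_⟩
    rw [hA, hA]
    exact ⟨mul_nonneg h4.le (by exact_mod_cast h1), mul_nonneg h4.le (by exact_mod_cast h2),
      h3.imp (fun h => mul_pos h4 (by exact_mod_cast h)) fun h => mul_pos h4 (by exact_mod_cast h)⟩
  · refine ⟨_, .inr rfl, isAff_legB i, ?_⟩
    rw [hB, hB]
    exact ⟨mul_nonneg h4.le (by exact_mod_cast h1), mul_nonneg h4.le (by exact_mod_cast h2),
      h3.imp (fun h => mul_pos h4 (by exact_mod_cast h)) fun h => mul_pos h4 (by exact_mod_cast h)⟩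

lemma layer_vertex_notMem {d i : ℕ} {hi : i + 1 < d} {k l : Fin 6} {x y w : HVert d}
    (h : InLayer d i hi k l x y) (hx : w ≠ x) (hy : w ≠ y) :
    (gridDrawing d).pos w ∉ segment ℝ ((gridDrawing d).pos x) ((gridDrawing d).pos y) := by
  rw [h.segment_eq]
  intro hmem
  rcases layer_trichotomy d i hi w with ⟨m, rfl⟩ | ⟨h0, hA, hB⟩ | hbig
  · have hm : m ≠ k ∧ m ≠ l := by
      constructor <;> rintro rfl <;> rcases Sym2.eq_iff.1 h.2.2 with ⟨e1, e2⟩ | ⟨e1, e2⟩ <;>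
        simp_all
    obtain ⟨c, hc, ho⟩ := orient_layerVert d i hi
    have key : ∀ k l m : Fin 6, (k, l) ∈ layerEdges → m ≠ k → m ≠ l →
        orientInt (layerPt k) (layerPt l) (layerPt m) ≠ 0 := by decide
    have hz := orient_eq_zero_of_mem_segment hmem
    rw [ho] at hz
    rcases mul_eq_zero.1 hz with hz | hz
    · exact hc hz
    · exact key k l m h.1 hm.1 hm.2 (by exact_mod_cast hz)
  · obtain ⟨M, hM, haff, h1, h2, -⟩ := exists_leg_nonneg (d := d) (hi := hi)
      (h.2.1.resolve_left h0.ne')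
    have := haff.nonneg h1 h2 hmem
    rcases hM with rfl | rfl <;> linarith
  · have hle : ∀ k, ((gridDrawing d).pos (layerVert d i hi k)).1 - 8 * 4 ^ i ≤ 0 := by
      intro k
      have hk : (layerPt k).1 ≤ 8 := by revert k; decide
      have hk' : ((layerPt k).1 : ℝ) ≤ 8 := by exact_mod_cast hk
      have h4 : (0 : ℝ) < 4 ^ i := by positivity
      rw [pos_layerVert]
      dsimp only
      nlinarith
    have haff : IsAff (fun p => p.1 - 8 * 4 ^ i) := ⟨1, 0, -(8 * 4 ^ i), fun p => by ring⟩
    have := haff.nonpos (hle k) (hle l) hmem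
    have h4 : (0 : ℝ) < 4 ^ i := by positivity
    linarith

lemma layer_inter_of_lt {d i j : ℕ} {hi : i + 1 < d} {hj : j + 1 < d} {k l m n : Fin 6}
    {x y z w : HVert d} (h : InLayer d j hj k l x y) (h' : InLayer d i hi m n z w) (hji : j < i)
    {p : Pt} (hp : p ∈ segment ℝ ((gridDrawing d).pos x) ((gridDrawing d).pos y))
    (hp' : p ∈ segment ℝ ((gridDrawing d).pos z) ((gridDrawing d).pos w)) :
    ∃ t, p = (gridDrawing d).pos t := by
  rw [h.segment_eq] at hp
  rw [h'.segment_eq] at hp'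
  obtain ⟨M, hM, haff, h1, h2, h3⟩ := exists_leg_nonneg (d := d) (hi := hi)
    (h'.2.1.resolve_left (by omega))
  have hk := leg_nonpos_of_lt hi hj hji k
  have hl := leg_nonpos_of_lt hi hj hji l
  have : M p ≤ 0 := by
    rcases hM with rfl | rfl
    · exact haff.nonpos hk.1 hl.1 hp
    · exact haff.nonpos hk.2 hl.2 hp
  exact (haff.eq_or_eq h1 h2 h3 hp' this).elim (fun h => ⟨_, h⟩) (fun h => ⟨_, h⟩)

lemma layer_inter_same {d i : ℕ} {hi : i + 1 < d} {k l m n : Fin 6}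
    {x y z w : HVert d} (h : InLayer d i hi k l x y) (h' : InLayer d i hi m n z w)
    (hne : s(x, y) ≠ s(z, w)) {p : Pt}
    (hp : p ∈ segment ℝ ((gridDrawing d).pos x) ((gridDrawing d).pos y))
    (hp' : p ∈ segment ℝ ((gridDrawing d).pos z) ((gridDrawing d).pos w)) :
    ∃ t, p = (gridDrawing d).pos t := by
  rw [h.segment_eq] at hp
  rw [h'.segment_eq] at hp'
  have hkm : (k, l) ≠ (m, n) := by
    rintro he
    obtain ⟨rfl, rfl⟩ := Prod.mk.inj he
    exact hne (h.2.2.trans h'.2.2.symm)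
  let o : Fin 6 → Fin 6 → Fin 6 → ℤ := fun k l m => orientInt (layerPt k) (layerPt l) (layerPt m)
  have key : ∀ e ∈ layerEdges, ∀ f ∈ layerEdges, e ≠ f →
      (0 ≤ o e.1 e.2 f.1 * o e.1 e.2 f.2 ∧ (o e.1 e.2 f.1 ≠ 0 ∨ o e.1 e.2 f.2 ≠ 0)) ∨
      (0 ≤ o f.1 f.2 e.1 * o f.1 f.2 e.2 ∧ (o f.1 f.2 e.1 ≠ 0 ∨ o f.1 f.2 e.2 ≠ 0)) := by
    decide
  obtain ⟨c, hc, ho⟩ := orient_layerVert d i hi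
  have lift : ∀ k l m n, 0 ≤ o k l m * o k l n → 0 ≤ c * (o k l m : ℝ) * (c * o k l n) := by
    intro k l m n h
    have h' : (0 : ℝ) ≤ o k l m * o k l n := by exact_mod_cast h
    nlinarith [mul_nonneg (sq_nonneg c) h']
  have lift' : ∀ k l m, o k l m ≠ 0 → c * (o k l m : ℝ) ≠ 0 :=
    fun k l m h => mul_ne_zero hc (by exact_mod_cast h)
  rcases key _ h.1 _ h'.1 hkm with ⟨h1, h2⟩ | ⟨h1, h2⟩
  · refine (eq_or_eq_of_weakly_separated ?_ ?_ hp hp').elim (fun h => ⟨_, h⟩) (fun h => ⟨_, h⟩)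
    · rw [ho, ho]; exact lift _ _ _ _ h1
    · rw [ho, ho]; exact h2.imp (lift' _ _ _) (lift' _ _ _)
  · refine (eq_or_eq_of_weakly_separated ?_ ?_ hp' hp).elim (fun h => ⟨_, h⟩) (fun h => ⟨_, h⟩)
    · rw [ho, ho]; exact lift _ _ _ _ h1
    · rw [ho, ho]; exact h2.imp (lift' _ _ _) (lift' _ _ _)

lemma gridDrawing_isPlanar {d : ℕ} (hd : 2 ≤ d) : (gridDrawing d).IsPlanar := by
  refine StraightDrawing.isPlanar_of_vertex_or_disjoint ?_ ?_
  · intro x y w hadj hx hy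
    obtain ⟨i, hi, k, l, h⟩ := exists_inLayer hd hadj
    exact layer_vertex_notMem h hx hy
  · intro x y z w hadj hadj' hne p hp hp'
    obtain ⟨i, hi, k, l, h⟩ := exists_inLayer hd hadj
    obtain ⟨j, hj, m, n, h'⟩ := exists_inLayer hd hadj'
    rcases lt_trichotomy i j with hij | rfl | hij
    · exact layer_inter_of_lt h h' hij hp hp'
    · exact layer_inter_same h h' hne hp hp'
    · exact layer_inter_of_lt h' h hij hp' hp

lemma gridDrawing_heightLe (d : ℕ) : (gridDrawing d).HeightLe 4 := by
  intro w
  refine ⟨(gridPos d w).2, ?_, ?_, rfl⟩ <;> cases w <;> simp only [gridPos] <;>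
    (try split_ifs) <;> norm_num

/-- For every `d ≥ 11`, the graph `H_d` (on `n = 3d` vertices) admits
a planar straight-line grid drawing of height 4, and every planar straight-line grid
drawing of `H_d` of height 4 has width at least `2^d / 3 = 2^{n/3} / 3`. -/
theorem stmt7 (d : ℕ) (hd : 11 ≤ d) :
    (∃ Γ : StraightDrawing (Hgraph d), Γ.IsPlanar ∧ Γ.IsGrid ∧ Γ.HeightLe 4) ∧
    (∀ Γ : StraightDrawing (Hgraph d), Γ.IsPlanar → Γ.IsGrid → Γ.HeightLe 4 →
      ∃ w₁ w₂ : HVert d, (2 : ℝ) ^ d / 3 ≤ (Γ.pos w₁).1 - (Γ.pos w₂).1 + 1) := by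
  refine ⟨⟨gridDrawing d, gridDrawing_isPlanar (by omega), fun w => ⟨gridPos d w, rfl⟩,
    gridDrawing_heightLe d⟩, fun Γ hΓ hgrid hheight => ?_⟩
  have := (isFan_Hgraph d (by omega)).width hΓ hgrid hheight (by omega)
  rwa [show d - 1 + 1 = d by omega] at this
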